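/- arXiv:2309.02128 — 4 statements merged into one kernel-verified Lean document; each statement's English description precedes it below -/
import Mathlib

section
/- Let G ⊂ ℝ^N (N ≥ 2) be a bounded b₀-John domain and let r, p, α be three numbers satisfying 1 ≤ p ≤ r ≤ Np/(N − p(1−α)), p(1−α) < N and 0 ≤ α ≤ 1. Then there exists a constant C > 0 such that for every function v : ℝ^N → ℝ which is integrable on G, differentiable on G, and satisfies ∫_G dist(x,∂G)^{αp} |∇v(x)|^p dx < ∞, one has (∫_G |v(x) − v_G|^r dx)^{1/r} ≤ C (∫_G dist(x,∂G)^{αp} |∇v(x)|^p dx)^{1/p}, where v_G := (1/|G|) ∫_G v dx is the mean value of v over G. -/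
open MeasureTheory Metric Set Real RealInnerProductSpace

noncomputable section

/-- Euclidean space `ℝ^N`. -/
abbrev Euc (N : ℕ) : Type := EuclideanSpace ℝ (Fin N)

/-- The `(i,j)` entry of the Hessian matrix of `u` at `x`. -/
def hessEntry {N : ℕ} (u : Euc N → ℝ) (x : Euc N) (i j : Fin N) : ℝ :=
  fderiv ℝ (fun y => fderiv ℝ u y (EuclideanSpace.single j (1 : ℝ))) x
    (EuclideanSpace.single i (1 : ℝ))

/-- Squared Frobenius norm of the Hessian of `u` at `x`. -/
def hessNormSq {N : ℕ} (u : Euc N → ℝ) (x : Euc N) : ℝ :=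
  ∑ i, ∑ j, (hessEntry u x i j) ^ 2

/-- The Laplacian of `u` at `x` (trace of the Hessian). -/
def lap {N : ℕ} (u : Euc N → ℝ) (x : Euc N) : ℝ := ∑ i, hessEntry u x i i

/-- `u` is a torsion function on `Ω`: continuous on the closure, `C²` inside,
`Δu = N` in `Ω` and `u = 0` on `∂Ω`. -/
def IsTorsion {N : ℕ} (Ω : Set (Euc N)) (u : Euc N → ℝ) : Prop :=
  ContinuousOn u (closure Ω) ∧ ContDiffOn ℝ 2 u Ω ∧
    (∀ x ∈ Ω, lap u x = N) ∧ ∀ x ∈ frontier Ω, u x = 0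

/-- `G` is a `b₀`-John domain. -/
def IsJohn {N : ℕ} (b₀ : ℝ) (G : Set (Euc N)) : Prop :=
  ∀ a ∈ G, ∀ b ∈ G, a ≠ b → ∃ γ : ℝ → Euc N,
    ContinuousOn γ (Icc 0 1) ∧ γ 0 = a ∧ γ 1 = b ∧ (∀ t ∈ Icc (0:ℝ) 1, γ t ∈ G) ∧
    ∀ t ∈ Icc (0:ℝ) 1, b₀⁻¹ * min (dist (γ t) a) (dist (γ t) b) ≤ infDist (γ t) (frontier G)

/-- `(θ, a)`-uniform interior cone condition. -/
def UnifConeCond {N : ℕ} (θ a : ℝ) (G : Set (Euc N)) : Prop :=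
  ∀ x ∈ frontier G, ∃ ω : Euc N, ‖ω‖ = 1 ∧
    ∀ w ∈ ball x a ∩ closure G, ∀ y : Euc N,
      ⟪y, ω⟫ > ‖y‖ * Real.cos θ → ‖y‖ < a → w + y ∈ G

/-- `r`-uniform interior sphere condition. -/
def IntSphere {N : ℕ} (r : ℝ) (Ω : Set (Euc N)) : Prop :=
  ∀ x ∈ frontier Ω, ∃ c : Euc N, ball c r ⊆ Ω ∧ dist x c = r

/-- `r`-uniform exterior sphere condition. -/
def ExtSphere {N : ℕ} (r : ℝ) (Ω : Set (Euc N)) : Prop :=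
  ∀ x ∈ frontier Ω, ∃ c : Euc N, ball c r ⊆ (closure Ω)ᶜ ∧ dist x c = r

open scoped ENNReal

/-- The increment of a differentiable function on `[a, b]` is at most the total variation of its
derivative, without any integrability assumption. -/
lemma enorm_sub_le_lintegral_deriv {f : ℝ → ℝ} {a b : ℝ} (hab : a ≤ b)
    (hf : ∀ t ∈ Icc a b, DifferentiableAt ℝ f t) :
    ‖f b - f a‖ₑ ≤ ∫⁻ t in Ioc a b, ‖deriv f t‖ₑ := by
  by_cases h : ∫⁻ t in Ioc a b, ‖deriv f t‖ₑ = ⊤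
  · simp [h]
  have hint : IntegrableOn (deriv f) (Ioc a b) :=
    ⟨(measurable_deriv f).aestronglyMeasurable, lt_top_iff_ne_top.2 h⟩
  have key := intervalIntegral.integral_eq_sub_of_hasDerivAt (a := a) (b := b) (f := f)
    (f' := deriv f) (fun t ht => (hf t (by rwa [uIcc_of_le hab] at ht)).hasDerivAt)
    ((intervalIntegrable_iff_integrableOn_Ioc_of_le hab).2 hint)
  rw [← key, intervalIntegral.integral_of_le hab]
  exact enorm_integral_le_lintegral_enorm _

lemma enorm_le_lintegral_deriv_of_hasCompactSupport {f : ℝ → ℝ} (hf : Differentiable ℝ f)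
    (hs : HasCompactSupport f) (x : ℝ) : ‖f x‖ₑ ≤ ∫⁻ t, ‖deriv f t‖ₑ := by
  obtain ⟨a, ha⟩ := hs.isCompact.bddBelow
  have hz : f (min a x - 1) = 0 := by
    by_contra h
    have := ha (subset_tsupport f h)
    linarith [min_le_left a x]
  have := enorm_sub_le_lintegral_deriv (f := f) (a := min a x - 1) (b := x)
    (by linarith [min_le_right a x]) (fun t _ => hf t)
  rw [hz, sub_zero] at this
  exact this.trans (setLIntegral_le_lintegral _ _)

/-- The **Gagliardo-Nirenberg-Sobolev inequality** for `W^{1,1}`, for functions that are merely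
differentiable everywhere. -/
lemma lintegral_rpow_le_lintegral_fderiv_rpow {N : ℕ} {q : ℝ} (hq : (N : ℝ).HolderConjugate q)
    {u : Euc N → ℝ} (hu : Differentiable ℝ u) (hs : HasCompactSupport u) :
    ∫⁻ x, ‖u x‖ₑ ^ q ≤ (∫⁻ x, ‖fderiv ℝ u x‖ₑ) ^ q := by
  classical
  have hN : (1 : ℝ) ≤ N - 1 := by
    have : (2 : ℝ) ≤ N := by exact_mod_cast hq.lt
    linarith
  have hT := PiLp.volume_preserving_toLp (Fin N)
  let e : (Fin N → ℝ) → Euc N := WithLp.toLp 2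
  have he : MeasurableEmbedding e := (MeasurableEquiv.toLp 2 (Fin N → ℝ)).measurableEmbedding
  rw [← hT.lintegral_comp_emb he, ← hT.lintegral_comp_emb he]
  have hmeas : Measurable fun x : Fin N → ℝ => ‖fderiv ℝ u (e x)‖ₑ :=
    (measurable_fderiv ℝ u).enorm.comp he.measurable
  calc ∫⁻ x, ‖u (e x)‖ₑ ^ q
      = ∫⁻ x, ∏ _i : Fin N, ‖u (e x)‖ₑ ^ (1 / (N - 1 : ℝ)) := by
        congr! 2 with x
        rw [Finset.prod_const, Finset.card_univ, Fintype.card_fin, ← ENNReal.rpow_natCast,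
          ← ENNReal.rpow_mul, hq.conjugate_eq]
        congr 1
        field_simp
    _ ≤ ∫⁻ x, ∏ i, (∫⁻ t, ‖fderiv ℝ u (e (Function.update x i t))‖ₑ) ^ (1 / (N - 1 : ℝ)) := by
        gcongr with x i
        have hd : ∀ t, HasDerivAt (fun t => u (e (Function.update x i t)))
            (fderiv ℝ u (e (Function.update x i t)) (EuclideanSpace.single i 1)) t := by
          intro t
          have h1 : HasDerivAt (fun t => e (Function.update x i t))
              (EuclideanSpace.single i (1 : ℝ)) t := by
            have := (PiLp.continuousLinearEquiv 2 ℝ (fun _ : Fin N => ℝ)).symm.hasFDerivAt.comp_hasDerivAt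
              t (hasDerivAt_update x i t)
            exact this
          exact (hu _).hasFDerivAt.comp_hasDerivAt t h1
        have h2 := enorm_le_lintegral_deriv_of_hasCompactSupport
          (f := fun t => u (e (Function.update x i t))) (fun t => (hd t).differentiableAt)
          (hs.comp_isClosedEmbedding
            ((PiLp.homeomorph 2 (fun _ : Fin N => ℝ)).symm.isClosedEmbedding.comp
              (isClosedEmbedding_update x i))) (x i)
        rw [Function.update_eq_self] at h2
        refine h2.trans (lintegral_mono fun t => ?_)
        rw [(hd t).deriv]
        refine (ContinuousLinearMap.le_opENorm _ _).trans ?_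
        have : ‖(EuclideanSpace.single i (1 : ℝ) : Euc N)‖ₑ = 1 := by
          rw [← ofReal_norm]; simp
        rw [this, mul_one]
    _ ≤ _ := by
        have := lintegral_prod_lintegral_pow_le (ι := Fin N) (A := fun _ => ℝ)
          (fun _ => volume) (p := q) (by simpa using hq) hmeas
        simpa only [Fintype.card_fin] using! this

lemma fderiv_abs_rpow_bound {N : ℕ} {u : Euc N → ℝ} {γ : ℝ} (hγ : 1 < γ)
    (hu : Differentiable ℝ u) :
    Differentiable ℝ (fun x => |u x| ^ γ) ∧ ∀ x, ‖fderiv ℝ (fun x => |u x| ^ γ) x‖ₑ ≤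
      ENNReal.ofReal γ * (‖u x‖ₑ ^ (γ - 1) * ‖fderiv ℝ u x‖ₑ) := by
  have h : ∀ x, HasFDerivAt (fun x => |u x| ^ γ)
      ((γ * |u x| ^ (γ - 2) * u x) • fderiv ℝ u x) x := fun x =>
    (hasDerivAt_abs_rpow (u x) hγ).comp_hasFDerivAt x (hu x).hasFDerivAt
  refine ⟨fun x => (h x).differentiableAt, fun x => ?_⟩
  rw [(h x).fderiv, enorm_smul, ← mul_assoc]
  gcongr
  rw [enorm_mul, enorm_mul, mul_assoc]
  gcongr
  · rw [Real.enorm_eq_ofReal (by positivity)]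
  · rw [Real.enorm_eq_ofReal_abs, Real.enorm_eq_ofReal_abs,
      ENNReal.ofReal_rpow_of_nonneg (abs_nonneg _) (by linarith), ← ENNReal.ofReal_mul (abs_nonneg _)]
    apply ENNReal.ofReal_le_ofReal
    rw [abs_of_nonneg (Real.rpow_nonneg (abs_nonneg (u x)) _)]
    rcases eq_or_ne (u x) 0 with h0 | h0
    · simp [h0, Real.zero_rpow (by linarith : γ - 1 ≠ 0)]
    · rw [← Real.rpow_add_one (abs_ne_zero.2 h0)]
      apply le_of_eq; congr 1; ring

lemma sobolev_aux {N : ℕ} {q : ℝ} (hq : (N : ℝ).HolderConjugate q) {p r : ℝ} (hp : 1 ≤ p)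
    (hr : 0 < r) {u : Euc N → ℝ} (hu : Differentiable ℝ u) (hs : HasCompactSupport u) :
    ∫⁻ x, ‖u x‖ₑ ^ ((1 + r * (p - 1) / p) * q) ≤
      (ENNReal.ofReal (1 + r * (p - 1) / p) *
        ((∫⁻ x, ‖u x‖ₑ ^ r) ^ (1 - 1 / p) * (∫⁻ x, ‖fderiv ℝ u x‖ₑ ^ p) ^ (1 / p))) ^ q := by
  have hq0 : 0 ≤ q := hq.symm.nonneg
  rcases hp.eq_or_lt with rfl | hp
  · simpa using lintegral_rpow_le_lintegral_fderiv_rpow hq hu hs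
  set γ := 1 + r * (p - 1) / p with hγ
  have hp0 : 0 < p := by linarith
  have hγ1 : 1 < γ := by
    have : 0 < r * (p - 1) / p := div_pos (mul_pos hr (by linarith)) hp0
    linarith
  obtain ⟨hd, hb⟩ := fderiv_abs_rpow_bound hγ1 hu
  have h1 := lintegral_rpow_le_lintegral_fderiv_rpow hq hd
    (hs.comp_left (g := fun t : ℝ => |t| ^ γ) (by simp [Real.zero_rpow (by linarith : γ ≠ 0)]))
  have hmu : Measurable fun x => ‖u x‖ₑ := hu.continuous.measurable.enorm
  have hmd : Measurable fun x => ‖fderiv ℝ u x‖ₑ := (measurable_fderiv ℝ u).enorm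
  calc ∫⁻ x, ‖u x‖ₑ ^ (γ * q) = ∫⁻ x, ‖|u x| ^ γ‖ₑ ^ q := by
        congr! 2 with x
        rw [ENNReal.rpow_mul, Real.enorm_eq_ofReal_abs, Real.enorm_eq_ofReal (by positivity),
          ENNReal.ofReal_rpow_of_nonneg (abs_nonneg _) (by linarith)]
    _ ≤ _ := h1
    _ ≤ _ := by
        gcongr
        calc _ ≤ ∫⁻ x, ENNReal.ofReal γ * (‖u x‖ₑ ^ (γ - 1) * ‖fderiv ℝ u x‖ₑ) :=
              lintegral_mono hb
          _ = ENNReal.ofReal γ * ∫⁻ x, ‖u x‖ₑ ^ (γ - 1) * ‖fderiv ℝ u x‖ₑ := by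
              rw [lintegral_const_mul]
              exact (hmu.pow_const _).mul hmd
          _ ≤ _ := by
              gcongr
              have hc : p.conjExponent.HolderConjugate p := (Real.HolderConjugate.conjExponent hp).symm
              refine (ENNReal.lintegral_mul_le_Lp_mul_Lq volume hc
                (hmu.pow_const _).aemeasurable hmd.aemeasurable).trans_eq ?_
              have e1 : (γ - 1) * p.conjExponent = r := by
                rw [hγ, Real.conjExponent]; field_simp [(by linarith : p - 1 ≠ 0)]; ring
              have e2 : 1 / p.conjExponent = 1 - 1 / p := by
                rw [Real.conjExponent]; field_simp [(by linarith : p - 1 ≠ 0)]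
              simp_rw [← ENNReal.rpow_mul, e1, e2]

/-- The **Sobolev inequality** for compactly supported differentiable functions. -/
lemma exists_sobolev_const {N : ℕ} (hN : 2 ≤ N) {p r : ℝ} (hp : 1 ≤ p) (hpr : p ≤ r)
    (h : N * (1 / p - 1 / r) ≤ 1) :
    ∃ C : ℝ≥0∞, C ≠ ⊤ ∧ ∀ u : Euc N → ℝ, Differentiable ℝ u → tsupport u ⊆ closedBall 0 1 →
      (∫⁻ x, ‖u x‖ₑ ^ r) ^ (1 / r) ≤ C * (∫⁻ x, ‖fderiv ℝ u x‖ₑ ^ p) ^ (1 / p) := by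
  have hN' : (2 : ℝ) ≤ N := by exact_mod_cast hN
  have hp0 : 0 < p := by linarith
  have hr0 : 0 < r := by linarith
  obtain ⟨q, hq⟩ : ∃ q, (N : ℝ).HolderConjugate q :=
    ⟨_, Real.HolderConjugate.conjExponent (by linarith)⟩
  have hqN : q * (N - 1) = N := by have := hq.mul_eq_add; linarith
  have hq0 : 0 < q := hq.symm.pos
  set γ := 1 + r * (p - 1) / p with hγ
  have hγ1 : 1 ≤ γ := by
    have : 0 ≤ r * (p - 1) / p := div_nonneg (mul_nonneg hr0.le (by linarith)) hp0.le
    linarith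
  have hrγ : r ≤ γ * q := by
    have h1 : (N : ℝ) * (r - p) ≤ r * p := by
      have := mul_le_mul_of_nonneg_right h (mul_pos hr0 hp0).le
      field_simp at this
      linarith
    have h3 : r * (N - 1) ≤ γ * N := by
      have : p * γ = p + r * (p - 1) := by rw [hγ]; field_simp
      have h4 : p * (r * (N - 1)) ≤ p * (γ * N) := by
        rw [← mul_assoc p γ, this]; nlinarith
      exact le_of_mul_le_mul_left h4 hp0
    have h2 : r * (N - 1) ≤ (γ * q) * (N - 1) := by
      rw [mul_assoc, hqN]; exact h3
    exact le_of_mul_le_mul_right h2 (by linarith)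
  set V := volume (closedBall (0 : Euc N) 1) with hV
  have hVt : V ≠ ⊤ := measure_closedBall_lt_top.ne
  refine ⟨V ^ ((1 / r - 1 / (γ * q)) * γ) * ENNReal.ofReal γ, ?_, fun u hu hsub => ?_⟩
  · refine ENNReal.mul_ne_top (ENNReal.rpow_ne_top_of_nonneg ?_ hVt) ENNReal.ofReal_ne_top
    have := one_div_le_one_div_of_le hr0 hrγ
    exact mul_nonneg (by linarith) (by linarith)
  have hs : HasCompactSupport u := (isCompact_closedBall 0 1).of_isClosed_subset
    (isClosed_tsupport u) hsub
  have hres : ∀ s : ℝ, 0 < s → ∫⁻ x, ‖u x‖ₑ ^ s = ∫⁻ x in closedBall 0 1, ‖u x‖ₑ ^ s := by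
    intro s hs0
    refine (setLIntegral_eq_of_support_subset ?_).symm
    intro x hx
    apply hsub
    apply subset_tsupport
    intro h0
    simp [h0, hs0] at hx
  set X := ∫⁻ x, ‖u x‖ₑ ^ r with hX
  set Y := (∫⁻ x, ‖fderiv ℝ u x‖ₑ ^ p) ^ (1 / p) with hY
  have hXt : X ≠ ⊤ := by
    obtain ⟨M, hM⟩ := hu.continuous.bounded_above_of_compact_support hs
    rw [hX, hres r hr0]
    refine ((setLIntegral_mono (g := fun _ => ENNReal.ofReal M ^ r) measurable_const
      fun x _ => ?_).trans_lt ?_).ne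
    · gcongr
      rw [← ofReal_norm]
      exact ENNReal.ofReal_le_ofReal (hM x)
    · rw [setLIntegral_const]
      exact ENNReal.mul_lt_top (ENNReal.rpow_lt_top_of_nonneg hr0.le ENNReal.ofReal_ne_top)
        hVt.lt_top
  rcases eq_or_ne X 0 with hX0 | hX0
  · rw [hX0, ENNReal.zero_rpow_of_pos (by positivity)]; exact zero_le
  have hmain := sobolev_aux hq hp hr0 hu hs
  rw [← hγ, ← hX, ← hY] at hmain
  have hH : X ^ (1 / r) ≤ (∫⁻ x, ‖u x‖ₑ ^ (γ * q)) ^ (1 / (γ * q)) * V ^ (1 / r - 1 / (γ * q)) := by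
    have := eLpNorm'_le_eLpNorm'_mul_rpow_measure_univ (μ := volume.restrict (closedBall 0 1))
      hr0 hrγ hu.continuous.aestronglyMeasurable
    rw [eLpNorm', eLpNorm', ← hres r hr0, ← hres _ (by positivity), Measure.restrict_apply_univ]
      at this
    exact this
  have hH2 : X ^ (γ / r) ≤ V ^ ((1 / r - 1 / (γ * q)) * γ) *
      (ENNReal.ofReal γ * (X ^ (1 - 1 / p) * Y)) := by
    calc X ^ (γ / r) = (X ^ (1 / r)) ^ γ := by rw [← ENNReal.rpow_mul]; congr 1; ring
      _ ≤ _ := ENNReal.rpow_le_rpow hH (by linarith)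
      _ = V ^ ((1 / r - 1 / (γ * q)) * γ) * (∫⁻ x, ‖u x‖ₑ ^ (γ * q)) ^ (1 / q) := by
        rw [ENNReal.mul_rpow_of_nonneg _ _ (by linarith), ← ENNReal.rpow_mul, ← ENNReal.rpow_mul,
          mul_comm]
        congr 2; field_simp
      _ ≤ _ := by
        gcongr
        calc _ ≤ _ := ENNReal.rpow_le_rpow hmain (by positivity)
          _ = _ := by rw [← ENNReal.rpow_mul, mul_one_div_cancel hq0.ne', ENNReal.rpow_one]
  have e : γ / r = 1 / r + (1 - 1 / p) := by rw [hγ]; field_simp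
  rw [e, ENNReal.rpow_add _ _ hX0 hXt] at hH2
  have hp1 : X ^ (1 - 1 / p) ≠ 0 := by
    simp [ENNReal.rpow_eq_zero_iff, hX0, hXt]
  have hp2 : X ^ (1 - 1 / p) ≠ ⊤ := by
    simp [ENNReal.rpow_eq_top_iff, hX0, hXt]
  rw [← ENNReal.mul_le_mul_iff_left hp1 hp2]
  refine hH2.trans_eq ?_
  ring

/-- Jensen's inequality for powers of lower integrals. -/
lemma lintegral_rpow_le_measure_rpow_mul {X : Type*} [MeasurableSpace X] {μ : Measure X}
    {f : X → ℝ≥0∞} (hf : AEMeasurable f μ) {p : ℝ} (hp : 1 ≤ p) :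
    (∫⁻ x, f x ∂μ) ^ p ≤ μ univ ^ (p - 1) * ∫⁻ x, f x ^ p ∂μ := by
  have hp0 : 0 < p := by linarith
  have := eLpNorm'_le_eLpNorm'_mul_rpow_measure_univ (μ := μ) zero_lt_one hp
    hf.aestronglyMeasurable
  simp only [eLpNorm', enorm_eq_self, ENNReal.rpow_one, div_one] at this
  calc _ ≤ _ := ENNReal.rpow_le_rpow this hp0.le
    _ = _ := by
      rw [ENNReal.mul_rpow_of_nonneg _ _ hp0.le, ← ENNReal.rpow_mul, ← ENNReal.rpow_mul,
        one_div_mul_cancel hp0.ne', ENNReal.rpow_one, mul_comm]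
      congr 2
      field_simp

lemma lintegral_comp_add_smul {N : ℕ} {g : Euc N → ℝ≥0∞} (hg : Measurable g) (a : Euc N) {t : ℝ}
    (ht : 0 < t) : ∫⁻ y, g (a + t • y) = ENNReal.ofReal (t⁻¹ ^ N) * ∫⁻ y, g y := by
  have h1 : ∫⁻ y, g (a + t • y) = ∫⁻ y, g (a + y) ∂(Measure.map (t • ·) volume) := by
    rw [lintegral_map (by fun_prop) (by fun_prop)]
  rw [h1, Measure.map_addHaar_smul _ ht.ne', lintegral_smul_measure, lintegral_add_left_eq_self,
    smul_eq_mul, finrank_euclideanSpace_fin, abs_of_pos (by positivity), inv_pow]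

lemma lintegral_lintegral_segment_le {N : ℕ} {g : Euc N → ℝ≥0∞} (hg : Measurable g) (t : ℝ)
    (B : Set (Euc N)) :
    ∫⁻ x in B, ∫⁻ y in B, g (x + t • (y - x)) ≤
      ENNReal.ofReal (2 ^ N) * volume B * ∫⁻ y, g y := by
  have bound : ∀ s : ℝ, 1 / 2 ≤ s → ∀ a : Euc N,
      ∫⁻ y in B, g (a + s • y) ≤ ENNReal.ofReal (2 ^ N) * ∫⁻ y, g y := by
    intro s hs a
    refine (setLIntegral_le_lintegral _ _).trans ?_
    rw [lintegral_comp_add_smul hg a (by linarith)]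
    gcongr
    rw [inv_le_comm₀ (by linarith) two_pos]
    linarith
  have hm : Measurable (Function.uncurry fun x y => g (x + t • (y - x))) := by
    have : Continuous fun z : Euc N × Euc N => z.1 + t • (z.2 - z.1) := by fun_prop
    exact hg.comp this.measurable
  rcases le_total (1 / 2) t with h | h
  · calc _ = ∫⁻ x in B, ∫⁻ y in B, g ((1 - t) • x + t • y) := by
          congr! 5 with x y; module
      _ ≤ ∫⁻ x in B, ENNReal.ofReal (2 ^ N) * ∫⁻ y, g y := lintegral_mono fun x => bound t h _
      _ = _ := by rw [setLIntegral_const]; ring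
  · rw [lintegral_lintegral_swap hm.aemeasurable]
    calc _ = ∫⁻ y in B, ∫⁻ x in B, g (t • y + (1 - t) • x) := by
          congr! 5 with x y; module
      _ ≤ ∫⁻ x in B, ENNReal.ofReal (2 ^ N) * ∫⁻ y, g y :=
          lintegral_mono fun x => bound (1 - t) (by linarith) _
      _ = _ := by rw [setLIntegral_const]; ring

lemma enorm_sub_le_lintegral_segment {N : ℕ} {B : Set (Euc N)} (hB : Convex ℝ B)
    (hBo : IsOpen B) {v : Euc N → ℝ}
    (hv : DifferentiableOn ℝ v B) {x y : Euc N} (hx : x ∈ B) (hy : y ∈ B) :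
    ‖v y - v x‖ₑ ≤ ‖y - x‖ₑ * ∫⁻ t in Ioc (0 : ℝ) 1, ‖fderiv ℝ v (x + t • (y - x))‖ₑ := by
  have hd : ∀ t ∈ Icc (0 : ℝ) 1, HasDerivAt (fun t : ℝ => v (x + t • (y - x)))
      (fderiv ℝ v (x + t • (y - x)) (y - x)) t := by
    intro t ht
    have h1 : HasDerivAt (fun t : ℝ => x + t • (y - x)) (y - x) t := by
      simpa using ((hasDerivAt_id t).smul_const (y - x)).const_add x
    have hm : x + t • (y - x) ∈ B := hB.add_smul_sub_mem hx hy ht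
    exact ((hv _ hm).differentiableAt (hBo.mem_nhds hm)).hasFDerivAt.comp_hasDerivAt t h1
  have := enorm_sub_le_lintegral_deriv zero_le_one fun t ht => (hd t ht).differentiableAt
  simp only [one_smul, zero_smul, add_zero, add_sub_cancel] at this
  refine this.trans ?_
  rw [← lintegral_const_mul]
  · refine setLIntegral_mono' measurableSet_Ioc fun t ht => ?_
    rw [(hd t ⟨ht.1.le, ht.2⟩).deriv, mul_comm]
    exact ContinuousLinearMap.le_opENorm _ _
  · exact ((measurable_fderiv ℝ v).comp (by fun_prop)).enorm

lemma lintegral_lintegral_lintegral_rotate {X T : Type*} [MeasurableSpace X] [MeasurableSpace T]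
    {μ : Measure X} {τ : Measure T} [SFinite μ] [SFinite τ] {H : (X × X) × T → ℝ≥0∞}
    (hH : Measurable H) :
    ∫⁻ x, ∫⁻ y, ∫⁻ t, H ((x, y), t) ∂τ ∂μ ∂μ = ∫⁻ t, ∫⁻ x, ∫⁻ y, H ((x, y), t) ∂μ ∂μ ∂τ := by
  have e : ∀ x, ∫⁻ y, ∫⁻ t, H ((x, y), t) ∂τ ∂μ = ∫⁻ t, ∫⁻ y, H ((x, y), t) ∂μ ∂τ := fun x =>
    lintegral_lintegral_swap (f := fun y t => H ((x, y), t))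
      (hH.comp ((measurable_const.prodMk measurable_fst).prodMk measurable_snd)).aemeasurable
  simp_rw [e]
  refine lintegral_lintegral_swap (f := fun x t => ∫⁻ y, H ((x, y), t) ∂μ) ?_
  refine (Measurable.lintegral_prod_right' (f := fun w : (X × T) × X => H ((w.1.1, w.2), w.1.2))
    (hH.comp ?_)).aemeasurable
  exact ((measurable_fst.comp measurable_fst).prodMk measurable_snd).prodMk
    (measurable_snd.comp measurable_fst)

/-- The **Poincaré inequality** on the unit ball. -/
lemma exists_poincare_const (N : ℕ) {p : ℝ} (hp : 1 ≤ p) :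
    ∃ C : ℝ≥0∞, C ≠ ⊤ ∧ ∀ v : Euc N → ℝ, DifferentiableOn ℝ v (ball 0 1) →
      IntegrableOn v (ball 0 1) →
      ∫⁻ x in ball (0 : Euc N) 1, ‖v x - ⨍ y in ball (0 : Euc N) 1, v y‖ₑ ^ p ≤
        C * ∫⁻ x in ball (0 : Euc N) 1, ‖fderiv ℝ v x‖ₑ ^ p := by
  have hp0 : 0 < p := by linarith
  set B := ball (0 : Euc N) 1 with hB
  have hVt : volume B ≠ ⊤ := measure_ball_lt_top.ne
  have : IsFiniteMeasure (volume.restrict B) := ⟨by simpa using hVt.lt_top⟩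
  have hV0 : volume B ≠ 0 := (measure_ball_pos volume _ one_pos).ne'
  refine ⟨(volume B)⁻¹ ^ p * volume B ^ (p - 1) * 2 ^ p * (ENNReal.ofReal (2 ^ N) * volume B),
    ?_, fun v hv hint => ?_⟩
  · refine ENNReal.mul_ne_top (ENNReal.mul_ne_top (ENNReal.mul_ne_top ?_ ?_) ?_)
      (ENNReal.mul_ne_top ENNReal.ofReal_ne_top hVt)
    · exact ENNReal.rpow_ne_top_of_nonneg hp0.le (ENNReal.inv_ne_top.2 hV0)
    · exact ENNReal.rpow_ne_top_of_nonneg (by linarith) hVt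
    · exact ENNReal.rpow_ne_top_of_nonneg hp0.le ENNReal.ofNat_ne_top
  set g : Euc N → ℝ≥0∞ := fun x => ‖fderiv ℝ v x‖ₑ with hg
  have hgm : Measurable g := (measurable_fderiv ℝ v).enorm
  set G : Euc N → ℝ≥0∞ := B.indicator fun x => g x ^ p with hG
  have hGm : Measurable G := (hgm.pow_const p).indicator measurableSet_ball
  have hGint : ∫⁻ x, G x = ∫⁻ x in B, g x ^ p := lintegral_indicator measurableSet_ball _
  have hvm : AEMeasurable v (volume.restrict B) :=
    hv.continuousOn.aemeasurable measurableSet_ball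
  have hpt : ∀ x ∈ B, ∀ y ∈ B, ‖v x - v y‖ₑ ^ p ≤
      2 ^ p * ∫⁻ t in Ioc (0 : ℝ) 1, G (x + t • (y - x)) := by
    intro x hx y hy
    have hconv : Convex ℝ B := convex_ball _ _
    have h1 := enorm_sub_le_lintegral_segment hconv isOpen_ball hv hx hy
    have h2 : ‖y - x‖ₑ ≤ 2 := by
      rw [← edist_eq_enorm_sub, edist_dist]
      refine (ENNReal.ofReal_le_ofReal (q := 2) ?_).trans_eq (ENNReal.ofReal_ofNat 2)
      have := dist_triangle_right y x 0
      linarith [mem_ball.1 hx, mem_ball.1 hy]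
    have hgc : Measurable fun t : ℝ => g (x + t • (y - x)) := hgm.comp (by fun_prop)
    have h3 := lintegral_rpow_le_measure_rpow_mul (μ := volume.restrict (Ioc (0 : ℝ) 1))
      hgc.aemeasurable hp
    simp only [Measure.restrict_apply_univ, Real.volume_Ioc, sub_zero, ENNReal.ofReal_one,
      ENNReal.one_rpow, one_mul] at h3
    rw [← edist_eq_enorm_sub, edist_comm, edist_eq_enorm_sub]
    calc _ ≤ (2 * ∫⁻ t in Ioc (0 : ℝ) 1, g (x + t • (y - x))) ^ p := by
          gcongr; exact h1.trans (by gcongr)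
      _ = 2 ^ p * (∫⁻ t in Ioc (0 : ℝ) 1, g (x + t • (y - x))) ^ p :=
          ENNReal.mul_rpow_of_nonneg _ _ hp0.le
      _ ≤ 2 ^ p * ∫⁻ t in Ioc (0 : ℝ) 1, g (x + t • (y - x)) ^ p := by gcongr
      _ = _ := by
          congr 1
          refine setLIntegral_congr_fun measurableSet_Ioc fun t ht => ?_
          have : x + t • (y - x) ∈ B := hconv.add_smul_sub_mem hx hy ⟨ht.1.le, ht.2⟩
          simp only [hG, indicator_of_mem this]
  have hmean : ∀ x ∈ B, ‖v x - ⨍ y in B, v y‖ₑ ^ p ≤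
      (volume B)⁻¹ ^ p * (volume B ^ (p - 1) * ∫⁻ y in B, ‖v x - v y‖ₑ ^ p) := by
    intro x hx
    have h1 : v x - ⨍ y in B, v y = (volume.real B)⁻¹ • ∫ y in B, (v x - v y) := by
      rw [integral_sub (integrable_const _) hint, setIntegral_const, smul_sub, smul_smul,
        inv_mul_cancel₀, one_smul, setAverage_eq]
      exact (measureReal_ne_zero_iff hVt).2 hV0
    have h2 : ‖(volume.real B)⁻¹‖ₑ = (volume B)⁻¹ := by
      rw [Real.enorm_eq_ofReal (by positivity), ENNReal.ofReal_inv_of_pos, ofReal_measureReal hVt]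
      exact ENNReal.toReal_pos hV0 hVt
    rw [h1, enorm_smul, h2, ENNReal.mul_rpow_of_nonneg _ _ hp0.le]
    gcongr
    refine (ENNReal.rpow_le_rpow (enorm_integral_le_lintegral_enorm _) hp0.le).trans ?_
    have := lintegral_rpow_le_measure_rpow_mul (μ := volume.restrict B)
      (f := fun y => ‖v x - v y‖ₑ) (hvm.const_sub _).enorm hp
    rwa [Measure.restrict_apply_univ] at this
  have hGc : Measurable fun z : (Euc N × Euc N) × ℝ => G (z.1.1 + z.2 • (z.1.2 - z.1.1)) := by
    have : Continuous fun z : (Euc N × Euc N) × ℝ => z.1.1 + z.2 • (z.1.2 - z.1.1) := by fun_prop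
    exact hGm.comp this.measurable
  calc _ ≤ ∫⁻ x in B, (volume B)⁻¹ ^ p * (volume B ^ (p - 1) *
        ∫⁻ y in B, 2 ^ p * ∫⁻ t in Ioc (0 : ℝ) 1, G (x + t • (y - x))) := by
        refine setLIntegral_mono' measurableSet_ball fun x hx => (hmean x hx).trans ?_
        refine mul_le_mul_right (mul_le_mul_right ?_ _) _
        exact setLIntegral_mono' measurableSet_ball fun y hy => hpt x hx y hy
    _ = (volume B)⁻¹ ^ p * volume B ^ (p - 1) * 2 ^ p *
        ∫⁻ x in B, ∫⁻ y in B, ∫⁻ t in Ioc (0 : ℝ) 1, G (x + t • (y - x)) := by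
        have m1 := hGc.lintegral_prod_right' (ν := volume.restrict (Ioc (0 : ℝ) 1))
        have m2 := m1.lintegral_prod_right' (ν := volume.restrict B)
        rw [← lintegral_const_mul _ m2]
        refine lintegral_congr fun x => ?_
        rw [lintegral_const_mul' _ _ (ENNReal.rpow_ne_top_of_nonneg hp0.le ENNReal.ofNat_ne_top)]
        ring
    _ = (volume B)⁻¹ ^ p * volume B ^ (p - 1) * 2 ^ p *
        ∫⁻ t in Ioc (0 : ℝ) 1, ∫⁻ x in B, ∫⁻ y in B, G (x + t • (y - x)) := by
        congr 1
        exact lintegral_lintegral_lintegral_rotate hGc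
    _ ≤ (volume B)⁻¹ ^ p * volume B ^ (p - 1) * 2 ^ p *
        ∫⁻ t in Ioc (0 : ℝ) 1, ENNReal.ofReal (2 ^ N) * volume B * ∫⁻ y, G y := by
        refine mul_le_mul_right (lintegral_mono fun t => ?_) _
        exact lintegral_lintegral_segment_le hGm t B
    _ = _ := by
        rw [setLIntegral_const, Real.volume_Ioc, sub_zero, ENNReal.ofReal_one, mul_one, hGint]
        ring

lemma exists_sobolev_poincare_const_unit_ball {N : ℕ} (hN : 2 ≤ N) {p r : ℝ} (hp : 1 ≤ p)
    (hpr : p ≤ r) (h : N * (1 / p - 1 / r) ≤ 1) :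
    ∃ C : ℝ≥0∞, C ≠ ⊤ ∧ ∀ v : Euc N → ℝ, DifferentiableOn ℝ v (ball 0 1) →
      IntegrableOn v (ball 0 1) → ∃ m : ℝ,
      ∫⁻ x in ball (0 : Euc N) (1 / 5), ‖v x - m‖ₑ ^ r ≤
        C * ((∫⁻ x in ball (0 : Euc N) 1, ‖fderiv ℝ v x‖ₑ ^ p) ^ (1 / p)) ^ r ∧
      ∫⁻ x in ball (0 : Euc N) 1, ‖v x - m‖ₑ ≤
        C * (∫⁻ x in ball (0 : Euc N) 1, ‖fderiv ℝ v x‖ₑ ^ p) ^ (1 / p) := by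
  have hp0 : 0 < p := by linarith
  have hr0 : 0 < r := by linarith
  obtain ⟨CP, hCP, hP⟩ := exists_poincare_const N hp
  obtain ⟨CS, hCS, hS⟩ := exists_sobolev_const hN hp hpr h
  let η : ContDiffBump (0 : Euc N) := ⟨1 / 5, 1 / 2, by norm_num, by norm_num⟩
  have hηd : ContDiff ℝ 1 (η : Euc N → ℝ) := η.contDiff
  obtain ⟨K, hK⟩ := (hηd.continuous_fderiv one_ne_zero).bounded_above_of_compact_support
    (η.hasCompactSupport.fderiv (𝕜 := ℝ))
  have hKe : ∀ x, ‖fderiv ℝ (η : Euc N → ℝ) x‖ₑ ≤ ENNReal.ofReal K := fun x => by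
    rw [← ofReal_norm]; exact ENNReal.ofReal_le_ofReal (hK x)
  set B := ball (0 : Euc N) 1 with hB
  have hts : tsupport (η : Euc N → ℝ) ⊆ B := by
    rw [η.tsupport_eq]
    exact closedBall_subset_ball (by norm_num [η])
  have hVt : volume B ≠ ⊤ := measure_ball_lt_top.ne
  set L : ℝ≥0∞ := 2 ^ (p - 1) * (1 + ENNReal.ofReal K ^ p * CP) with hL
  have hLt : L ≠ ⊤ := ENNReal.mul_ne_top
    (ENNReal.rpow_ne_top_of_nonneg (by linarith) ENNReal.ofNat_ne_top)
    (ENNReal.add_ne_top.2 ⟨ENNReal.one_ne_top, ENNReal.mul_ne_top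
      (ENNReal.rpow_ne_top_of_nonneg hp0.le ENNReal.ofReal_ne_top) hCP⟩)
  set C1 : ℝ≥0∞ := (CS * L ^ (1 / p)) ^ r with hC1
  set C2 : ℝ≥0∞ := (volume B ^ (p - 1) * CP) ^ (1 / p) with hC2
  refine ⟨C1 + C2, ENNReal.add_ne_top.2 ⟨?_, ?_⟩, fun v hv hint => ?_⟩
  · exact ENNReal.rpow_ne_top_of_nonneg hr0.le (ENNReal.mul_ne_top hCS
      (ENNReal.rpow_ne_top_of_nonneg (by positivity) hLt))
  · exact ENNReal.rpow_ne_top_of_nonneg (by positivity) (ENNReal.mul_ne_top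
      (ENNReal.rpow_ne_top_of_nonneg (by linarith) hVt) hCP)
  have hPv := hP v hv hint
  set m := ⨍ y in B, v y with hm
  set D := ∫⁻ x in B, ‖fderiv ℝ v x‖ₑ ^ p with hD
  have hvm : AEMeasurable v (volume.restrict B) :=
    hv.continuousOn.aemeasurable measurableSet_ball
  have hvd : ∀ x ∈ B, DifferentiableAt ℝ v x := fun x hx =>
    (hv x hx).differentiableAt (isOpen_ball.mem_nhds hx)
  refine ⟨m, ?_, ?_⟩
  · set u : Euc N → ℝ := fun x => η x * (v x - m) with hu
    have hout : ∀ x, x ∉ B → u =ᶠ[nhds x] fun _ => (0 : ℝ) := by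
      intro x hx
      have : x ∉ tsupport (η : Euc N → ℝ) := fun h => hx (hts h)
      filter_upwards [notMem_tsupport_iff_eventuallyEq.1 this] with y hy
      simp [hu, hy]
    have hud : Differentiable ℝ u := by
      intro x
      by_cases hx : x ∈ B
      · exact (hηd.differentiable one_ne_zero x).mul ((hvd x hx).sub_const m)
      · exact (hout x hx).differentiableAt_iff.2 (differentiableAt_const _)
    have hus : tsupport u ⊆ closedBall 0 1 :=
      (closure_mono (Function.support_mul_subset_left _ _)).trans (hts.trans ball_subset_closedBall)
    have hfd : ∀ x ∈ B, ‖fderiv ℝ u x‖ₑ ≤ ‖fderiv ℝ v x‖ₑ + ENNReal.ofReal K * ‖v x - m‖ₑ := by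
      intro x hx
      have : fderiv ℝ u x = η x • fderiv ℝ (fun y => v y - m) x + (v x - m) • fderiv ℝ η x :=
        ((hηd.differentiable one_ne_zero x).hasFDerivAt.mul
          ((hvd x hx).sub_const m).hasFDerivAt).fderiv
      rw [this, fderiv_sub_const]
      refine (enorm_add_le (η x • fderiv ℝ v x) ((v x - m) • fderiv ℝ η x)).trans ?_
      rw [enorm_smul, enorm_smul, mul_comm ‖v x - m‖ₑ]
      gcongr
      · have h1 : ‖η x‖ₑ ≤ 1 := by
          rw [Real.enorm_eq_ofReal η.nonneg]; exact ENNReal.ofReal_le_one.2 η.le_one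
        exact mul_le_of_le_one_left' h1
      · exact hKe x
    have hDu : ∫⁻ x, ‖fderiv ℝ u x‖ₑ ^ p ≤ L * D := by
      calc ∫⁻ x, ‖fderiv ℝ u x‖ₑ ^ p = ∫⁻ x in B, ‖fderiv ℝ u x‖ₑ ^ p := by
            refine (setLIntegral_eq_of_support_subset fun x hx => ?_).symm
            by_contra hxB
            apply hx
            have : fderiv ℝ u x = 0 := by rw [(hout x hxB).fderiv_eq]; simp
            rw [this, ← ofReal_norm, norm_zero, ENNReal.ofReal_zero, ENNReal.zero_rpow_of_pos hp0]
        _ ≤ ∫⁻ x in B, 2 ^ (p - 1) * (‖fderiv ℝ v x‖ₑ ^ p +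
              ENNReal.ofReal K ^ p * ‖v x - m‖ₑ ^ p) := by
            refine setLIntegral_mono' measurableSet_ball fun x hx => ?_
            refine (ENNReal.rpow_le_rpow (hfd x hx) hp0.le).trans ?_
            refine (ENNReal.rpow_add_le_mul_rpow_add_rpow _ _ hp).trans_eq ?_
            rw [ENNReal.mul_rpow_of_nonneg _ _ hp0.le]
        _ = 2 ^ (p - 1) * (D + ENNReal.ofReal K ^ p * ∫⁻ x in B, ‖v x - m‖ₑ ^ p) := by
            rw [lintegral_const_mul' _ _
                (ENNReal.rpow_ne_top_of_nonneg (by linarith) ENNReal.ofNat_ne_top),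
              lintegral_add_left ((measurable_fderiv ℝ v).enorm.pow_const p),
              lintegral_const_mul' _ _
                (ENNReal.rpow_ne_top_of_nonneg hp0.le ENNReal.ofReal_ne_top)]
        _ ≤ 2 ^ (p - 1) * (D + ENNReal.ofReal K ^ p * (CP * D)) := by gcongr
        _ = L * D := by rw [hL]; ring
    have h1 := hS u hud hus
    calc ∫⁻ x in ball (0 : Euc N) (1 / 5), ‖v x - m‖ₑ ^ r
        = ∫⁻ x in ball (0 : Euc N) (1 / 5), ‖u x‖ₑ ^ r := by
          refine setLIntegral_congr_fun measurableSet_ball fun x hx => ?_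
          have : η x = 1 := η.one_of_mem_closedBall (ball_subset_closedBall hx)
          simp [hu, this]
      _ ≤ ∫⁻ x, ‖u x‖ₑ ^ r := setLIntegral_le_lintegral _ _
      _ = ((∫⁻ x, ‖u x‖ₑ ^ r) ^ (1 / r)) ^ r := by
          rw [← ENNReal.rpow_mul, one_div_mul_cancel hr0.ne', ENNReal.rpow_one]
      _ ≤ (CS * (L * D) ^ (1 / p)) ^ r := by
          gcongr
          exact h1.trans (by gcongr)
      _ = C1 * (D ^ (1 / p)) ^ r := by
          rw [ENNReal.mul_rpow_of_nonneg L D (by positivity), ← mul_assoc,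
            ENNReal.mul_rpow_of_nonneg _ _ hr0.le]
      _ ≤ _ := by gcongr; exact le_self_add
  · have h1 := lintegral_rpow_le_measure_rpow_mul (μ := volume.restrict B)
      (f := fun y => ‖v y - m‖ₑ) (hvm.sub_const _).enorm hp
    rw [Measure.restrict_apply_univ] at h1
    calc ∫⁻ x in B, ‖v x - m‖ₑ = ((∫⁻ x in B, ‖v x - m‖ₑ) ^ p) ^ (1 / p) := by
          rw [← ENNReal.rpow_mul, mul_one_div_cancel hp0.ne', ENNReal.rpow_one]
      _ ≤ (volume B ^ (p - 1) * (CP * D)) ^ (1 / p) := by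
          gcongr
          exact h1.trans (by gcongr)
      _ = C2 * D ^ (1 / p) := by
          rw [← mul_assoc, ENNReal.mul_rpow_of_nonneg _ _ (by positivity)]
      _ ≤ _ := by gcongr; exact le_add_self

lemma map_add_smul_volume {N : ℕ} (z : Euc N) {R : ℝ} (hR : 0 < R) :
    MeasurableEmbedding (fun y : Euc N => z + R • y) ∧
      Measure.map (fun y : Euc N => z + R • y) volume =
        ENNReal.ofReal (R⁻¹ ^ N) • (volume : Measure (Euc N)) := by
  constructor
  · exact ((Homeomorph.smulOfNeZero R hR.ne').trans (Homeomorph.addLeft z)).measurableEmbedding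
  · ext s hs
    have hf : Measurable fun y : Euc N => z + R • y := by fun_prop
    rw [Measure.smul_apply, smul_eq_mul, ← lintegral_indicator_one hs,
      ← lintegral_indicator_one hs, lintegral_map (measurable_one.indicator hs) hf,
      ← lintegral_comp_add_smul (measurable_one.indicator hs) z hR]

lemma preimage_add_smul_ball {N : ℕ} (z : Euc N) {R ρ : ℝ} (hR : 0 < R) :
    (fun y : Euc N => z + R • y) ⁻¹' (ball z (R * ρ)) = ball 0 ρ := by
  ext y
  simp [norm_smul, abs_of_pos hR, hR]

lemma setLIntegral_ball_eq_unit {N : ℕ} (F : Euc N → ℝ≥0∞) (z : Euc N) {R : ℝ} (hR : 0 < R)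
    (ρ : ℝ) : ∫⁻ x in ball z (R * ρ), F x =
      ENNReal.ofReal R ^ N * ∫⁻ y in ball 0 ρ, F (z + R • y) := by
  obtain ⟨he, hmap⟩ := map_add_smul_volume z hR
  have h1 : ∫⁻ y in ball 0 ρ, F (z + R • y) = ENNReal.ofReal (R⁻¹ ^ N) *
      ∫⁻ x in ball z (R * ρ), F x := by
    rw [← smul_eq_mul, ← lintegral_smul_measure, ← Measure.restrict_smul, ← hmap,
      he.restrict_map, he.lintegral_map, preimage_add_smul_ball z hR]
  rw [h1, ← mul_assoc, ← ENNReal.ofReal_pow hR.le, ← ENNReal.ofReal_mul (by positivity),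
    ← mul_pow, mul_inv_cancel₀ hR.ne', one_pow, ENNReal.ofReal_one, one_mul]

/-- Scale-invariant **Sobolev-Poincaré inequality** on balls. -/
lemma exists_sobolev_poincare_const {N : ℕ} (hN : 2 ≤ N) {p r : ℝ} (hp : 1 ≤ p)
    (hpr : p ≤ r) (h : N * (1 / p - 1 / r) ≤ 1) :
    ∃ C : ℝ≥0∞, C ≠ ⊤ ∧ ∀ (z : Euc N) (R : ℝ) (v : Euc N → ℝ), 0 < R →
      DifferentiableOn ℝ v (ball z R) → IntegrableOn v (ball z R) → ∃ m : ℝ,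
      ∫⁻ x in ball z (R / 5), ‖v x - m‖ₑ ^ r ≤
        C * ENNReal.ofReal R ^ N * ((ENNReal.ofReal (R ^ (p - N)) *
          ∫⁻ x in ball z R, ‖fderiv ℝ v x‖ₑ ^ p) ^ (1 / p)) ^ r ∧
      ∫⁻ x in ball z R, ‖v x - m‖ₑ ≤
        C * ENNReal.ofReal R ^ N * (ENNReal.ofReal (R ^ (p - N)) *
          ∫⁻ x in ball z R, ‖fderiv ℝ v x‖ₑ ^ p) ^ (1 / p) := by
  obtain ⟨C, hC, H⟩ := exists_sobolev_poincare_const_unit_ball hN hp hpr h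
  refine ⟨C, hC, fun z R v hR hv hint => ?_⟩
  have hp0 : 0 < p := by linarith
  have hmt : MapsTo (fun y : Euc N => z + R • y) (ball 0 1) (ball z R) := by
    intro y hy
    rw [← preimage_add_smul_ball z (R := R) hR, mul_one] at hy
    exact hy
  obtain ⟨he, hmap⟩ := map_add_smul_volume z hR
  have hfd : ∀ y ∈ ball (0 : Euc N) 1, HasFDerivAt (fun y => v (z + R • y))
      (R • fderiv ℝ v (z + R • y)) y := by
    intro y hy
    have h1 : HasFDerivAt (fun y : Euc N => z + R • y) (R • ContinuousLinearMap.id ℝ (Euc N)) y :=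
      ((hasFDerivAt_id y).const_smul R).const_add z
    have h2 := ((hv _ (hmt hy)).differentiableAt (isOpen_ball.mem_nhds (hmt hy))).hasFDerivAt.comp
      y h1
    rwa [ContinuousLinearMap.comp_smul, ContinuousLinearMap.comp_id] at h2
  obtain ⟨m, h1, h2⟩ := H (fun y => v (z + R • y))
    (fun y hy => (hfd y hy).differentiableAt.differentiableWithinAt) (by
      have : IntegrableOn v (ball z R) (Measure.map (fun y : Euc N => z + R • y) volume) := by
        rw [hmap, IntegrableOn, Measure.restrict_smul]
        exact hint.smul_measure ENNReal.ofReal_ne_top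
      rw [he.integrableOn_map_iff] at this
      have e := preimage_add_smul_ball (ρ := 1) z hR
      rw [mul_one] at e
      rwa [e] at this)
  have hD : ∫⁻ x in ball (0 : Euc N) 1, ‖fderiv ℝ (fun y => v (z + R • y)) x‖ₑ ^ p =
      ENNReal.ofReal (R ^ (p - N)) * ∫⁻ x in ball z R, ‖fderiv ℝ v x‖ₑ ^ p := by
    have e := setLIntegral_ball_eq_unit (fun x => ‖fderiv ℝ v x‖ₑ ^ p) z hR 1
    rw [mul_one] at e
    rw [e, ← mul_assoc, ← ENNReal.ofReal_pow hR.le, ← ENNReal.ofReal_mul (by positivity),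
      ← Real.rpow_natCast R N, ← Real.rpow_add hR, sub_add_cancel,
      ← lintegral_const_mul' _ _ ENNReal.ofReal_ne_top]
    refine setLIntegral_congr_fun measurableSet_ball fun y hy => ?_
    beta_reduce
    rw [(hfd y hy).fderiv, enorm_smul, ENNReal.mul_rpow_of_nonneg _ _ hp0.le,
      Real.enorm_eq_ofReal hR.le, ENNReal.ofReal_rpow_of_nonneg hR.le hp0.le]
  rw [hD] at h1 h2
  refine ⟨m, ?_, ?_⟩
  · rw [div_eq_mul_one_div R 5, setLIntegral_ball_eq_unit _ z hR, mul_comm C, mul_assoc]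
    gcongr
  · have e := setLIntegral_ball_eq_unit (fun x => ‖v x - m‖ₑ) z hR 1
    rw [mul_one] at e
    rw [e, mul_comm C, mul_assoc]
    gcongr

lemma sum_measure_le_of_lt_average {N : ℕ} {ι : Type*} (S : Finset ι) (z : ι → Euc N) {ρ : ι → ℝ}
    (hρ : ∀ k ∈ S, 0 < ρ k) {b : ι → Set (Euc N)} (hb : ∀ k ∈ S, MeasurableSet (b k))
    (hdisj : (S : Set ι).PairwiseDisjoint b) (hsub : ∀ k ∈ S, b k ⊆ closedBall (z k) (ρ k))
    {h : Euc N → ℝ} (hh : Measurable h) {t : ℝ} (ht : 0 < t)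
    (hA : ∀ k ∈ S, ENNReal.ofReal t * volume (closedBall (z k) (ρ k)) ≤
      ∫⁻ x in closedBall (z k) (ρ k), ENNReal.ofReal (h x)) :
    ∑ k ∈ S, volume (b k) ≤
      ENNReal.ofReal (5 ^ N * (2 / t)) * ∫⁻ x in {x | t < 2 * h x}, ENNReal.ofReal (h x) := by
  have hT : MeasurableSet {x | t < 2 * h x} := measurableSet_lt measurable_const (hh.const_mul 2)
  have hball : ∀ k ∈ S, ENNReal.ofReal (t / 2) * volume (closedBall (z k) (ρ k)) ≤
      ∫⁻ x in closedBall (z k) (ρ k) ∩ {x | t < 2 * h x}, ENNReal.ofReal (h x) := by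
    intro k hk
    have h1 : ∫⁻ x in closedBall (z k) (ρ k), ENNReal.ofReal (h x) ≤
        ∫⁻ x in closedBall (z k) (ρ k), (ENNReal.ofReal (t / 2) +
          {x | t < 2 * h x}.indicator (fun x => ENNReal.ofReal (h x)) x) := by
      refine lintegral_mono fun x => ?_
      by_cases hx : t < 2 * h x
      · rw [indicator_of_mem (show x ∈ {x | t < 2 * h x} from hx)]
        exact le_add_self
      · exact (ENNReal.ofReal_le_ofReal (by linarith)).trans le_self_add
    rw [lintegral_add_left measurable_const, lintegral_const, Measure.restrict_apply_univ,
      lintegral_indicator hT, Measure.restrict_restrict hT, inter_comm] at h1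
    have h2 := (hA k hk).trans h1
    have h3 : ENNReal.ofReal t = ENNReal.ofReal (t / 2) + ENNReal.ofReal (t / 2) := by
      rw [← ENNReal.ofReal_add (by positivity) (by positivity), add_halves]
    rw [h3, add_mul] at h2
    exact (ENNReal.add_le_add_iff_left (ENNReal.mul_ne_top ENNReal.ofReal_ne_top
      measure_closedBall_lt_top.ne)).1 h2
  obtain ⟨R, hR⟩ : ∃ R, ∀ k ∈ S, ρ k ≤ R :=
    ⟨∑ k ∈ S, |ρ k|, fun k hk => (le_abs_self _).trans
      (Finset.single_le_sum (f := fun k => |ρ k|) (fun i _ => abs_nonneg _) hk)⟩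
  obtain ⟨u, huS, hud, hu⟩ := Vitali.exists_disjoint_subfamily_covering_enlargement_closedBall
    (S : Set ι) z ρ R hR 5 (by norm_num)
  lift u to Finset ι using S.finite_toSet.subset huS
  rw [Finset.coe_subset] at huS
  calc ∑ k ∈ S, volume (b k) = volume (⋃ k ∈ S, b k) := (measure_biUnion_finset hdisj hb).symm
    _ ≤ volume (⋃ k ∈ u, closedBall (z k) (5 * ρ k)) := by
        refine measure_mono (iUnion₂_subset fun k hk => (hsub k hk).trans ?_)
        obtain ⟨j, hj, hkj⟩ := hu k hk
        exact hkj.trans (subset_biUnion_of_mem (u := fun k => closedBall (z k) (5 * ρ k)) hj)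
    _ ≤ ∑ k ∈ u, volume (closedBall (z k) (5 * ρ k)) := measure_biUnion_finset_le _ _
    _ = ∑ k ∈ u, ENNReal.ofReal (5 ^ N * (2 / t)) *
          (ENNReal.ofReal (t / 2) * volume (closedBall (z k) (ρ k))) := by
        refine Finset.sum_congr rfl fun k hk => ?_
        have hk0 := (hρ k (huS hk)).le
        rw [← mul_assoc, ← ENNReal.ofReal_mul (by positivity), Measure.addHaar_closedBall _ _ hk0,
          Measure.addHaar_closedBall _ _ (by positivity), ← mul_assoc,
          ← ENNReal.ofReal_mul (by positivity), finrank_euclideanSpace_fin]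
        congr 2
        field_simp
        rw [mul_pow]
    _ ≤ ∑ k ∈ u, ENNReal.ofReal (5 ^ N * (2 / t)) *
          ∫⁻ x in closedBall (z k) (ρ k) ∩ {x | t < 2 * h x}, ENNReal.ofReal (h x) := by
        gcongr with k hk
        exact hball k (huS hk)
    _ = ENNReal.ofReal (5 ^ N * (2 / t)) *
          ∫⁻ x in ⋃ k ∈ u, closedBall (z k) (ρ k) ∩ {x | t < 2 * h x}, ENNReal.ofReal (h x) := by
        rw [← Finset.mul_sum, lintegral_biUnion_finset
          (hud.mono fun k => inter_subset_left)
          (fun k _ => measurableSet_closedBall.inter hT)]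
    _ ≤ _ := by
        gcongr
        exact iUnion₂_subset fun k _ => inter_subset_right

lemma sum_measure_mul_average_rpow_le {N : ℕ} {ι : Type*} (S : Finset ι) (z : ι → Euc N)
    {ρ : ι → ℝ} (hρ : ∀ k ∈ S, 0 < ρ k) {b : ι → Set (Euc N)}
    (hb : ∀ k ∈ S, MeasurableSet (b k)) (hdisj : (S : Set ι).PairwiseDisjoint b)
    (hsub : ∀ k ∈ S, b k ⊆ closedBall (z k) (ρ k))
    {h : Euc N → ℝ} (hh : Measurable h) (hh0 : ∀ x, 0 ≤ h x) {s : ℝ} (hs : 1 < s) {A : ι → ℝ}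
    (hA0 : ∀ k, 0 ≤ A k) (hA : ∀ k ∈ S, ENNReal.ofReal (A k) * volume (closedBall (z k) (ρ k)) ≤
      ∫⁻ x in closedBall (z k) (ρ k), ENNReal.ofReal (h x)) :
    ∑ k ∈ S, volume (b k) * ENNReal.ofReal (A k ^ s) ≤
      ENNReal.ofReal (5 ^ N * 2 ^ s * s / (s - 1)) * ∫⁻ x, ENNReal.ofReal (h x ^ s) := by
  classical
  let _ : MeasurableSpace ι := ⊤
  have hs0 : 0 < s := by linarith
  have hs1 : 0 < s - 1 := by linarith
  set μ : Measure ι := ∑ k ∈ S, volume (b k) • Measure.dirac k with hμ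
  set ν : Measure (Euc N) := volume.withDensity fun x => ENNReal.ofReal (h x) with hν
  have hweak : ∀ t > 0, μ {k | t < A k} ≤
      ENNReal.ofReal (5 ^ N * (2 / t)) * ν {x | t < 2 * h x} := by
    intro t ht
    have hT : MeasurableSet {x | t < 2 * h x} :=
      measurableSet_lt measurable_const (hh.const_mul 2)
    have e : μ {k | t < A k} = ∑ k ∈ S with t < A k, volume (b k) := by
      rw [hμ, Measure.finsetSum_apply, Finset.sum_filter]
      refine Finset.sum_congr rfl fun k _ => ?_
      rw [Measure.smul_apply, Measure.dirac_apply' _ MeasurableSpace.measurableSet_top,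
        indicator_apply]
      simp
    rw [e, hν, withDensity_apply _ hT]
    have hmem : ∀ k ∈ S.filter (fun k => t < A k), k ∈ S ∧ t < A k := fun k hk =>
      Finset.mem_filter.1 hk
    refine sum_measure_le_of_lt_average _ z (fun k hk => hρ k (hmem k hk).1)
      (fun k hk => hb k (hmem k hk).1) (hdisj.subset fun k hk => (hmem k hk).1)
      (fun k hk => hsub k (hmem k hk).1) hh ht fun k hk => ?_
    refine le_trans ?_ (hA k (hmem k hk).1)
    gcongr
    exact (hmem k hk).2.le
  calc ∑ k ∈ S, volume (b k) * ENNReal.ofReal (A k ^ s)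
      = ∫⁻ k, ENNReal.ofReal (A k ^ s) ∂μ := by
        rw [hμ, lintegral_finsetSum_measure]
        refine Finset.sum_congr rfl fun k _ => ?_
        rw [lintegral_smul_measure, lintegral_dirac' _ measurable_from_top, smul_eq_mul]
    _ = ENNReal.ofReal s * ∫⁻ t in Ioi 0, μ {k | t < A k} * ENNReal.ofReal (t ^ (s - 1)) :=
        lintegral_rpow_eq_lintegral_meas_lt_mul μ (ae_of_all _ hA0)
          measurable_from_top.aemeasurable hs0
    _ ≤ ENNReal.ofReal s * ∫⁻ t in Ioi 0, ENNReal.ofReal (5 ^ N * 2) *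
          (ν {x | t < 2 * h x} * ENNReal.ofReal (t ^ (s - 1 - 1))) := by
        gcongr ENNReal.ofReal s * ?_
        refine setLIntegral_mono' measurableSet_Ioi fun t (ht : 0 < t) => ?_
        refine (mul_le_mul_left (hweak t ht) _).trans_eq ?_
        have : t ^ (s - 1) = t * t ^ (s - 1 - 1) := by
          rw [← Real.rpow_one_add' ht.le (by linarith)]; ring_nf
        rw [this, ENNReal.ofReal_mul ht.le, show 5 ^ N * (2 / t) = 5 ^ N * 2 * t⁻¹ by ring,
          ENNReal.ofReal_mul (p := 5 ^ N * 2) (by positivity)]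
        have h1 : ENNReal.ofReal t⁻¹ * ENNReal.ofReal t = 1 := by
          rw [← ENNReal.ofReal_mul (by positivity), inv_mul_cancel₀ ht.ne', ENNReal.ofReal_one]
        calc _ = ENNReal.ofReal (5 ^ N * 2) * (ENNReal.ofReal t⁻¹ * ENNReal.ofReal t) *
              (ν {x | t < 2 * h x} * ENNReal.ofReal (t ^ (s - 1 - 1))) := by ring
          _ = _ := by rw [h1, mul_one]
    _ = ENNReal.ofReal (5 ^ N * 2 * s / (s - 1)) * (ENNReal.ofReal (s - 1) *
          ∫⁻ t in Ioi 0, ν {x | t < 2 * h x} * ENNReal.ofReal (t ^ (s - 1 - 1))) := by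
        rw [lintegral_const_mul' _ _ ENNReal.ofReal_ne_top, ← mul_assoc, ← mul_assoc,
          ← ENNReal.ofReal_mul hs0.le, ← ENNReal.ofReal_mul (by positivity)]
        congr 2
        field_simp
    _ = ENNReal.ofReal (5 ^ N * 2 * s / (s - 1)) *
          ∫⁻ x, ENNReal.ofReal ((2 * h x) ^ (s - 1)) ∂ν := by
        rw [lintegral_rpow_eq_lintegral_meas_lt_mul ν
          (ae_of_all _ fun x => mul_nonneg two_pos.le (hh0 x)) (hh.const_mul 2).aemeasurable hs1]
    _ = ENNReal.ofReal (5 ^ N * 2 * s / (s - 1)) *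
          ∫⁻ x, ENNReal.ofReal (2 ^ (s - 1)) * ENNReal.ofReal (h x ^ s) := by
        rw [hν, lintegral_withDensity_eq_lintegral_mul _ hh.ennreal_ofReal
          (((hh.const_mul 2).pow_const _).ennreal_ofReal)]
        congr 2
        ext x
        rw [Pi.mul_apply, ← ENNReal.ofReal_mul (hh0 x), ← ENNReal.ofReal_mul (by positivity),
          Real.mul_rpow two_pos.le (hh0 x)]
        congr 1
        have : h x ^ s = h x * h x ^ (s - 1) := by
          rw [← Real.rpow_one_add' (hh0 x) (by linarith)]; ring_nf
        rw [this]; ring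
    _ = _ := by
        rw [lintegral_const_mul' _ _ ENNReal.ofReal_ne_top, ← mul_assoc,
          ← ENNReal.ofReal_mul (by positivity)]
        congr 2
        have : (2 : ℝ) ^ s = 2 * 2 ^ (s - 1) := by
          rw [← Real.rpow_one_add' two_pos.le (by linarith)]; ring_nf
        rw [this]; ring

lemma lintegral_sum_indicator_rpow_le {N : ℕ} {ι : Type*} (S : Finset ι) (z : ι → Euc N)
    {ρ : ι → ℝ} (hρ : ∀ k ∈ S, 0 < ρ k) {b : ι → Set (Euc N)}
    (hb : ∀ k ∈ S, MeasurableSet (b k)) (hdisj : (S : Set ι).PairwiseDisjoint b)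
    (hsub : ∀ k ∈ S, b k ⊆ closedBall (z k) (ρ k)) {κ : ℝ≥0∞}
    (hκ : ∀ k ∈ S, volume (closedBall (z k) (ρ k)) ≤ κ * volume (b k))
    {r : ℝ} (hr : 1 < r) {a : ι → ℝ} (ha : ∀ k, 0 ≤ a k) :
    ∫⁻ x, ENNReal.ofReal ((∑ k ∈ S, (closedBall (z k) (ρ k)).indicator (fun _ => a k) x) ^ r) ≤
      (κ * ENNReal.ofReal (5 ^ N * 2 ^ (r / (r - 1)) * r) ^ ((r - 1) / r)) ^ r *
        ∑ k ∈ S, volume (b k) * ENNReal.ofReal (a k ^ r) := by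
  have hr0 : 0 < r := by linarith
  have hr1 : 0 < r - 1 := by linarith
  set F : Euc N → ℝ := fun x => ∑ k ∈ S, (closedBall (z k) (ρ k)).indicator (fun _ => a k) x
    with hF
  have hF0 : ∀ x, 0 ≤ F x := fun x => Finset.sum_nonneg fun k _ =>
    indicator_nonneg (fun _ _ => ha k) x
  have hFm : Measurable F := Finset.measurable_sum S fun k _ =>
    measurable_const.indicator measurableSet_closedBall
  have hFle : ∀ x, F x ≤ ∑ k ∈ S, a k := fun x => Finset.sum_le_sum fun k _ =>
    indicator_le_self' (fun _ _ => ha k) x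
  set h : Euc N → ℝ := fun x => F x ^ (r - 1) with hh
  have hh0 : ∀ x, 0 ≤ h x := fun x => Real.rpow_nonneg (hF0 x) _
  have hhm : Measurable h := hFm.pow_const _
  have hint : ∀ k, ∫⁻ x in closedBall (z k) (ρ k), ENNReal.ofReal (h x) ≠ ⊤ := by
    intro k
    refine ((setLIntegral_mono' measurableSet_closedBall
      (g := fun _ => ENNReal.ofReal ((∑ k ∈ S, a k) ^ (r - 1))) fun x _ => ?_).trans_lt ?_).ne
    · exact ENNReal.ofReal_le_ofReal (Real.rpow_le_rpow (hF0 x) (hFle x) hr1.le)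
    · rw [setLIntegral_const]
      exact ENNReal.mul_lt_top ENNReal.ofReal_lt_top measure_closedBall_lt_top
  set A : ι → ℝ := fun k => ((∫⁻ x in closedBall (z k) (ρ k), ENNReal.ofReal (h x)) /
    volume (closedBall (z k) (ρ k))).toReal with hA
  have hVpos : ∀ k ∈ S, volume (closedBall (z k) (ρ k)) ≠ 0 := fun k hk =>
    (measure_closedBall_pos volume _ (hρ k hk)).ne'
  have hAe : ∀ k ∈ S, ENNReal.ofReal (A k) * volume (closedBall (z k) (ρ k)) =
      ∫⁻ x in closedBall (z k) (ρ k), ENNReal.ofReal (h x) := by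
    intro k hk
    rw [hA, ENNReal.ofReal_toReal (ENNReal.div_ne_top (hint k) (hVpos k hk)),
      ENNReal.div_mul_cancel (hVpos k hk) measure_closedBall_lt_top.ne]
  set s : ℝ := r / (r - 1) with hs
  have hs1 : 1 < s := by rw [hs, lt_div_iff₀ hr1]; linarith
  have hs0 : 0 < s := by linarith
  have hconj : r.HolderConjugate s := Real.HolderConjugate.conjExponent hr
  have hC := sum_measure_mul_average_rpow_le S z hρ hb hdisj hsub hhm hh0 hs1
    (A := A) (fun k => ENNReal.toReal_nonneg) (fun k hk => (hAe k hk).le)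
  have hhs : ∀ x, h x ^ s = F x ^ r := fun x => by
    rw [hh, hs, ← Real.rpow_mul (hF0 x), mul_div_cancel₀ _ hr1.ne']
  simp_rw [hhs] at hC
  have hsr : 5 ^ N * 2 ^ s * s / (s - 1) = 5 ^ N * 2 ^ s * r := by
    have : s - 1 ≠ 0 := by linarith
    have h2 : s / (s - 1) = r := by
      rw [div_eq_iff this, hs]; field_simp; ring
    rw [mul_div_assoc, h2]
  rw [hsr] at hC
  set X := ∫⁻ x, ENNReal.ofReal (F x ^ r) with hX
  set Y := ∑ k ∈ S, volume (b k) * ENNReal.ofReal (a k ^ r) with hY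
  set C0 := ENNReal.ofReal (5 ^ N * 2 ^ s * r) with hC0
  have hXe : X = ∑ k ∈ S, ENNReal.ofReal (a k) *
      ∫⁻ x in closedBall (z k) (ρ k), ENNReal.ofReal (h x) := by
    have : ∀ x, ENNReal.ofReal (F x ^ r) = ∑ k ∈ S, (closedBall (z k) (ρ k)).indicator
        (fun x => ENNReal.ofReal (a k) * ENNReal.ofReal (h x)) x := by
      intro x
      have e : F x ^ r = F x * h x := by
        rw [hh, ← Real.rpow_one_add' (hF0 x) (by linarith)]; ring_nf
      rw [e, hF, Finset.sum_mul, ENNReal.ofReal_sum_of_nonneg fun k _ =>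
        mul_nonneg (indicator_nonneg (fun _ _ => ha k) x) (hh0 x)]
      refine Finset.sum_congr rfl fun k _ => ?_
      by_cases hx : x ∈ closedBall (z k) (ρ k)
      · rw [indicator_of_mem hx, indicator_of_mem hx, ENNReal.ofReal_mul (ha k)]
      · rw [indicator_of_notMem hx, indicator_of_notMem hx, zero_mul, ENNReal.ofReal_zero]
    rw [hX]
    simp_rw [this]
    rw [lintegral_finsetSum _ fun k _ =>
      (hhm.ennreal_ofReal.const_mul _).indicator measurableSet_closedBall]
    refine Finset.sum_congr rfl fun k _ => ?_
    rw [lintegral_indicator measurableSet_closedBall,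
      lintegral_const_mul' _ _ ENNReal.ofReal_ne_top]
  have hXt : X ≠ ⊤ := by
    rw [hXe]
    exact (ENNReal.sum_lt_top.2 fun k _ =>
      ENNReal.mul_lt_top ENNReal.ofReal_lt_top (hint k).lt_top).ne
  have key : X ≤ κ * (Y ^ (1 / r) * (C0 * X) ^ (1 / s)) := by
    calc X ≤ κ * ∑ k ∈ S, (volume (b k) ^ (1 / r) * ENNReal.ofReal (a k)) *
            (volume (b k) ^ (1 / s) * ENNReal.ofReal (A k)) := by
          rw [hXe, Finset.mul_sum]
          refine Finset.sum_le_sum fun k hk => ?_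
          rw [← hAe k hk]
          have e : volume (b k) = volume (b k) ^ (1 / r) * volume (b k) ^ (1 / s) := by
            rw [← ENNReal.rpow_add_of_nonneg _ _ (by positivity) (by positivity), one_div, one_div,
              hconj.inv_add_inv_eq_one, ENNReal.rpow_one]
          calc _ ≤ ENNReal.ofReal (a k) * (ENNReal.ofReal (A k) * (κ * volume (b k))) := by
                gcongr; exact hκ k hk
            _ = κ * (volume (b k) * (ENNReal.ofReal (a k) * ENNReal.ofReal (A k))) := by ring
            _ = _ := by
              conv_lhs => rw [e]
              ring
      _ ≤ _ := by
          gcongr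
          refine (ENNReal.inner_le_Lp_mul_Lq S _ _ hconj).trans ?_
          gcongr
          · refine (Finset.sum_congr rfl fun k _ => ?_).le
            rw [ENNReal.mul_rpow_of_nonneg _ _ hr0.le, ← ENNReal.rpow_mul,
              one_div_mul_cancel hr0.ne', ENNReal.rpow_one,
              ENNReal.ofReal_rpow_of_nonneg (ha k) hr0.le]
          · refine (Finset.sum_congr rfl fun k _ => ?_).le.trans hC
            rw [ENNReal.mul_rpow_of_nonneg _ _ hs0.le, ← ENNReal.rpow_mul,
              one_div_mul_cancel hs0.ne', ENNReal.rpow_one,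
              ENNReal.ofReal_rpow_of_nonneg ENNReal.toReal_nonneg hs0.le]
  have h1s : 1 / s = (r - 1) / r := by rw [hs, one_div_div]
  by_cases hX0 : X = 0
  · rw [hX0]; exact zero_le
  have hsplit : X = X ^ (1 / r) * X ^ (1 / s) := by
    rw [← ENNReal.rpow_add_of_nonneg _ _ (by positivity) (by positivity), one_div, one_div,
      hconj.inv_add_inv_eq_one, ENNReal.rpow_one]
  have hXs0 : X ^ (1 / s) ≠ 0 := by
    rw [Ne, ENNReal.rpow_eq_zero_iff]; push Not; exact ⟨fun h => absurd h hX0, fun h => absurd h hXt⟩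
  have hXst : X ^ (1 / s) ≠ ⊤ := ENNReal.rpow_ne_top_of_nonneg (by positivity) hXt
  rw [ENNReal.mul_rpow_of_nonneg _ _ (by positivity)] at key
  have key2 : X ^ (1 / r) ≤ κ * C0 ^ (1 / s) * Y ^ (1 / r) := by
    have : X ^ (1 / r) * X ^ (1 / s) ≤ κ * C0 ^ (1 / s) * Y ^ (1 / r) * X ^ (1 / s) := by
      rw [← hsplit]; exact key.trans_eq (by ring)
    exact (ENNReal.mul_le_mul_iff_left hXs0 hXst).1 this
  calc X = (X ^ (1 / r)) ^ r := by
        rw [← ENNReal.rpow_mul, one_div_mul_cancel hr0.ne', ENNReal.rpow_one]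
    _ ≤ (κ * C0 ^ (1 / s) * Y ^ (1 / r)) ^ r := by gcongr
    _ = _ := by
      rw [ENNReal.mul_rpow_of_nonneg _ (Y ^ (1 / r)) hr0.le, ← ENNReal.rpow_mul,
        one_div_mul_cancel hr0.ne', ENNReal.rpow_one, h1s]

/-- **Boman's lemma**: dilating disjoint balls by a bounded factor is harmless in `L^r`. -/
lemma exists_lintegral_tsum_indicator_rpow_le (N : ℕ) {ε lam r : ℝ} (hε : 0 < ε) (hl : ε ≤ lam)
    (hr : 1 ≤ r) : ∃ C : ℝ≥0∞, C ≠ ⊤ ∧ ∀ (ι : Type) [Countable ι] (z : ι → Euc N) (R : ι → ℝ)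
      (a : ι → ℝ≥0∞), (∀ k, 0 < R k) →
      (Pairwise fun i j => Disjoint (closedBall (z i) (ε * R i)) (closedBall (z j) (ε * R j))) →
      ∫⁻ x, (∑' k, (closedBall (z k) (lam * R k)).indicator (fun _ => a k) x) ^ r ≤
        C * ∑' k, a k ^ r * ENNReal.ofReal (R k) ^ N := by
  have hr0 : 0 < r := by linarith
  have hl0 : 0 < lam := by linarith
  set V := volume (ball (0 : Euc N) 1) with hV
  have hVt : V ≠ ⊤ := measure_ball_lt_top.ne
  set κ : ℝ≥0∞ := ENNReal.ofReal ((lam / ε) ^ N) with hκ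
  have hvol : ∀ (z : Euc N) {c R : ℝ}, 0 < c → 0 < R → volume (closedBall z (c * R)) =
      ENNReal.ofReal (c ^ N) * V * ENNReal.ofReal R ^ N := by
    intro z c R hc hR
    rw [Measure.addHaar_closedBall _ _ (by positivity), finrank_euclideanSpace_fin, mul_pow,
      ENNReal.ofReal_mul (by positivity), ENNReal.ofReal_pow hR.le]
    ring
  obtain ⟨C, hCt, hC⟩ : ∃ C : ℝ≥0∞, C ≠ ⊤ ∧ ∀ (ι : Type) (S : Finset ι) (z : ι → Euc N)
      (R : ι → ℝ) (a : ι → ℝ), (∀ k, 0 < R k) → (∀ k, 0 ≤ a k) →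
      (Pairwise fun i j => Disjoint (closedBall (z i) (ε * R i)) (closedBall (z j) (ε * R j))) →
      ∫⁻ x, ENNReal.ofReal
        ((∑ k ∈ S, (closedBall (z k) (lam * R k)).indicator (fun _ => a k) x) ^ r) ≤
        C * ∑ k ∈ S, ENNReal.ofReal (a k ^ r) * ENNReal.ofReal (R k) ^ N := by
    rcases hr.eq_or_lt with rfl | hr1
    · refine ⟨ENNReal.ofReal (lam ^ N) * V, ENNReal.mul_ne_top ENNReal.ofReal_ne_top hVt,
        fun ι S z R a hR ha _ => ?_⟩
      simp_rw [Real.rpow_one]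
      have : ∀ x, ENNReal.ofReal (∑ k ∈ S, (closedBall (z k) (lam * R k)).indicator
          (fun _ => a k) x) = ∑ k ∈ S, (closedBall (z k) (lam * R k)).indicator
          (fun _ => ENNReal.ofReal (a k)) x := by
        intro x
        rw [ENNReal.ofReal_sum_of_nonneg fun k _ => indicator_nonneg (fun _ _ => ha k) x]
        refine Finset.sum_congr rfl fun k _ => ?_
        by_cases hx : x ∈ closedBall (z k) (lam * R k) <;> simp [hx]
      simp_rw [this]
      rw [lintegral_finsetSum _ fun k _ => measurable_const.indicator measurableSet_closedBall,
        Finset.mul_sum]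
      refine Finset.sum_le_sum fun k _ => ?_
      rw [lintegral_indicator measurableSet_closedBall, setLIntegral_const,
        hvol _ hl0 (hR k)]
      exact le_of_eq (by ring)
    · refine ⟨(κ * ENNReal.ofReal (5 ^ N * 2 ^ (r / (r - 1)) * r) ^ ((r - 1) / r)) ^ r *
        (ENNReal.ofReal (ε ^ N) * V), ?_, fun ι S z R a hR ha hd => ?_⟩
      · refine ENNReal.mul_ne_top (ENNReal.rpow_ne_top_of_nonneg hr0.le (ENNReal.mul_ne_top
          ENNReal.ofReal_ne_top (ENNReal.rpow_ne_top_of_nonneg ?_ ENNReal.ofReal_ne_top)))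
          (ENNReal.mul_ne_top ENNReal.ofReal_ne_top hVt)
        exact div_nonneg (by linarith) hr0.le
      · refine (lintegral_sum_indicator_rpow_le S z (ρ := fun k => lam * R k)
          (b := fun k => closedBall (z k) (ε * R k)) (κ := κ) (fun k _ => mul_pos hl0 (hR k))
          (fun k _ => measurableSet_closedBall) (hd.set_pairwise _)
          (fun k _ => closedBall_subset_closedBall (by have := hR k; gcongr)) (fun k _ => ?_)
          hr1 ha).trans_eq ?_
        · rw [hvol _ hl0 (hR k), hvol _ hε (hR k), hκ, ← mul_assoc, ← mul_assoc,
            ← ENNReal.ofReal_mul (by positivity), ← mul_pow, div_mul_cancel₀ _ hε.ne']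
        · rw [mul_assoc _ (ENNReal.ofReal (ε ^ N) * V),
            Finset.mul_sum (a := ENNReal.ofReal (ε ^ N) * V)]
          congr 1
          refine Finset.sum_congr rfl fun k _ => ?_
          rw [hvol _ hε (hR k)]
          ring
  refine ⟨C + 1, ENNReal.add_ne_top.2 ⟨hCt, ENNReal.one_ne_top⟩, fun ι _ z R a hR hd => ?_⟩
  by_cases ha : ∃ k, a k = ⊤
  · obtain ⟨k, hk⟩ := ha
    have : ∑' k, a k ^ r * ENNReal.ofReal (R k) ^ N = ⊤ := by
      refine ENNReal.tsum_eq_top_of_eq_top ⟨k, ?_⟩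
      rw [hk, ENNReal.top_rpow_of_pos hr0, ENNReal.top_mul]
      exact pow_ne_zero _ (ENNReal.ofReal_pos.2 (hR k)).ne'
    rw [this, ENNReal.mul_top (by simp)]
    exact le_top
  push Not at ha
  have hsup : ∀ x, (∑' k, (closedBall (z k) (lam * R k)).indicator (fun _ => a k) x) ^ r =
      ⨆ S : Finset ι, (∑ k ∈ S, (closedBall (z k) (lam * R k)).indicator (fun _ => a k) x) ^ r := by
    intro x
    rw [ENNReal.tsum_eq_iSup_sum]
    exact (ENNReal.orderIsoRpow r hr0).map_iSup _
  have hm : ∀ S : Finset ι, Measurable fun x =>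
      (∑ k ∈ S, (closedBall (z k) (lam * R k)).indicator (fun _ => a k) x) ^ r := fun S =>
    (Finset.measurable_sum S fun k _ =>
      measurable_const.indicator measurableSet_closedBall).pow_const r
  simp_rw [hsup]
  rw [lintegral_iSup_directed (fun S => (hm S).aemeasurable)]
  · refine iSup_le fun S => ?_
    have e : ∀ x, (∑ k ∈ S, (closedBall (z k) (lam * R k)).indicator (fun _ => a k) x) ^ r =
        ENNReal.ofReal ((∑ k ∈ S, (closedBall (z k) (lam * R k)).indicator
          (fun _ => (a k).toReal) x) ^ r) := by
      intro x
      have h0 : ∀ k, 0 ≤ (closedBall (z k) (lam * R k)).indicator (fun _ => (a k).toReal) x :=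
        fun k => indicator_nonneg (fun _ _ => ENNReal.toReal_nonneg) x
      rw [← ENNReal.ofReal_rpow_of_nonneg (Finset.sum_nonneg fun k _ => h0 k) hr0.le,
        ENNReal.ofReal_sum_of_nonneg fun k _ => h0 k]
      congr 1
      refine Finset.sum_congr rfl fun k _ => ?_
      by_cases hx : x ∈ closedBall (z k) (lam * R k) <;> simp [hx, ENNReal.ofReal_toReal (ha k)]
    simp_rw [e]
    refine (hC ι S z R (fun k => (a k).toReal) hR (fun k => ENNReal.toReal_nonneg) hd).trans ?_
    gcongr
    · exact le_self_add
    · refine le_trans (Finset.sum_le_sum fun k _ => ?_) (ENNReal.sum_le_tsum S)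
      rw [← ENNReal.ofReal_rpow_of_nonneg ENNReal.toReal_nonneg hr0.le,
        ENNReal.ofReal_toReal (ha k)]
  · intro S T
    classical
    refine ⟨S ∪ T, fun x => ?_, fun x => ?_⟩ <;> dsimp only <;> gcongr
    · exact Finset.subset_union_left
    · exact Finset.subset_union_right

/-- Telescoping along a connected set covered by open sets: the values attached to two members of
the cover differ by at most the sum of the local oscillations along the set. -/
lemma enorm_sub_le_tsum_of_isPreconnected {X ι : Type*} [TopologicalSpace X] [Countable ι]
    {K : Set X} (hK : IsPreconnected K) {U : ι → Set X} (hU : ∀ i, IsOpen (U i))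
    (hcov : K ⊆ ⋃ i, U i) {c : ι → ℝ} {a : ι → ℝ≥0∞}
    (h : ∀ i j, (U i ∩ U j).Nonempty → ‖c i - c j‖ₑ ≤ a i + a j) {i j : ι}
    (hi : (K ∩ U i).Nonempty) (hj : (K ∩ U j).Nonempty) :
    ‖c i - c j‖ₑ ≤ ∑' k, {k | (K ∩ U k).Nonempty}.indicator (fun k => 2 * a k) k := by
  wlog hle : c i ≤ c j generalizing i j
  · rw [← enorm_neg, neg_sub]
    exact this hj hi (le_of_not_ge hle)
  classical
  set T := {k | (K ∩ U k).Nonempty} with hT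
  have hsub : Icc (c i) (c j) ⊆ ⋃ k, if k ∈ T then closedEBall (c k) (a k) else ∅ := by
    intro t ht
    by_contra hcon
    have hlt : ∀ k ∈ T, a k < ‖t - c k‖ₑ := by
      intro k hk
      by_contra hle
      refine hcon (mem_iUnion.2 ⟨k, ?_⟩)
      rw [if_pos hk, mem_closedEBall, edist_eq_enorm_sub]
      exact not_lt.1 hle
    have hne : ∀ k ∈ T, c k ≠ t := by
      rintro k hk rfl
      simpa using hlt k hk
    obtain ⟨y, hyK, hyA, hyB⟩ := hK (⋃ k ∈ {k | k ∈ T ∧ c k < t}, U k)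
      (⋃ k ∈ {k | k ∈ T ∧ t < c k}, U k) (isOpen_biUnion fun k _ => hU k)
      (isOpen_biUnion fun k _ => hU k) (by
        intro y hy
        obtain ⟨k, hk⟩ := mem_iUnion.1 (hcov hy)
        have hkT : k ∈ T := ⟨y, hy, hk⟩
        rcases lt_or_gt_of_ne (hne k hkT) with h1 | h1
        · exact Or.inl (mem_biUnion (show k ∈ {k | k ∈ T ∧ c k < t} from ⟨hkT, h1⟩) hk)
        · exact Or.inr (mem_biUnion (show k ∈ {k | k ∈ T ∧ t < c k} from ⟨hkT, h1⟩) hk))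
      (hi.mono fun y hy => ⟨hy.1, mem_biUnion (show i ∈ {k | k ∈ T ∧ c k < t} from
        ⟨hi, lt_of_le_of_ne ht.1 (hne i hi)⟩) hy.2⟩)
      (hj.mono fun y hy => ⟨hy.1, mem_biUnion (show j ∈ {k | k ∈ T ∧ t < c k} from
        ⟨hj, lt_of_le_of_ne ht.2 (hne j hj).symm⟩) hy.2⟩)
    obtain ⟨k, ⟨hkT, hkt⟩, hyk⟩ := mem_iUnion₂.1 hyA
    obtain ⟨l, ⟨hlT, hlt'⟩, hyl⟩ := mem_iUnion₂.1 hyB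
    have h1 := h k l ⟨y, hyk, hyl⟩
    have h2 := ENNReal.add_lt_add (hlt k hkT) (hlt l hlT)
    refine absurd (h1.trans_lt h2) (not_lt.2 ?_)
    rw [Real.enorm_eq_ofReal_abs, Real.enorm_eq_ofReal_abs, Real.enorm_eq_ofReal_abs,
      ← ENNReal.ofReal_add (abs_nonneg _) (abs_nonneg _)]
    refine ENNReal.ofReal_le_ofReal ?_
    rw [abs_of_pos (sub_pos.2 hkt), abs_of_neg (sub_neg.2 hlt'),
      abs_of_neg (sub_neg.2 (hkt.trans hlt'))]
    linarith
  calc ‖c i - c j‖ₑ = volume (Icc (c i) (c j)) := by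
        rw [Real.volume_Icc, ← enorm_neg, neg_sub, Real.enorm_eq_ofReal (sub_nonneg.2 hle)]
    _ ≤ ∑' k, volume (if k ∈ T then closedEBall (c k) (a k) else ∅) :=
        (measure_mono hsub).trans (measure_iUnion_le _)
    _ = _ := by
        refine tsum_congr fun k => ?_
        by_cases hk : k ∈ T
        · rw [if_pos hk, indicator_of_mem hk, Real.volume_closedEBall]
        · rw [if_neg hk, indicator_of_notMem hk, measure_empty]

lemma frontier_nonempty_of_isBounded {E : Type*} [NormedAddCommGroup E] [NormedSpace ℝ E]
    [Nontrivial E] {G : Set E} (hne : G.Nonempty) (hb : Bornology.IsBounded G) :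
    (frontier G).Nonempty := by
  refine nonempty_frontier_iff.2 ⟨hne, ?_⟩
  rintro rfl
  exact NormedSpace.unbounded_univ ℝ E hb

lemma infDist_frontier_pos {X : Type*} [PseudoMetricSpace X] {G : Set X} (hG : IsOpen G)
    (hf : (frontier G).Nonempty) {x : X} (hx : x ∈ G) : 0 < infDist x (frontier G) := by
  refine (isClosed_frontier.notMem_iff_infDist_pos hf).1 fun h => ?_
  rw [hG.frontier_eq] at h
  exact h.2 hx

lemma ball_infDist_frontier_subset {E : Type*} [SeminormedAddCommGroup E] [NormedSpace ℝ E]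
    {G : Set E} (hG : IsOpen G) {x : E} (hx : x ∈ G) :
    ball x (infDist x (frontier G)) ⊆ G := by
  rcases le_or_gt (infDist x (frontier G)) 0 with h0 | h0
  · rw [ball_eq_empty.2 h0]; exact empty_subset _
  refine (convex_ball x _).isPreconnected.subset_left_of_subset_union hG
    isClosed_closure.isOpen_compl (disjoint_compl_right.mono_left subset_closure) ?_
    ⟨x, mem_ball_self h0, hx⟩
  intro y hy
  have := ball_infDist_subset_compl hy
  rw [hG.frontier_eq] at this
  by_contra h
  simp only [mem_union, mem_compl_iff, not_or, not_not] at h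
  exact this ⟨h.2, h.1⟩

lemma infDist_frontier_le_diam {X : Type*} [PseudoMetricSpace X] {G : Set X}
    (hb : Bornology.IsBounded G) (hf : (frontier G).Nonempty) {x : X} (hx : x ∈ G) :
    infDist x (frontier G) ≤ diam (closure G) := by
  obtain ⟨y, hy⟩ := hf
  exact (infDist_le_dist_of_mem hy).trans
    (dist_le_diam_of_mem hb.closure (subset_closure hx) (frontier_subset_closure hy))

/-- In a bounded John domain each point is joined to a fixed centre by a connected carrot. -/
lemma IsJohn.exists_carrot {N : ℕ} {b₀ : ℝ} (hb₀ : 1 ≤ b₀) {G : Set (Euc N)} (hJ : IsJohn b₀ G)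
    (hG : IsOpen G) (hb : Bornology.IsBounded G) (hf : (frontier G).Nonempty) {o : Euc N}
    (ho : o ∈ G) : ∃ c > 0, ∀ x ∈ G, ∃ K ⊆ G, IsPreconnected K ∧ x ∈ K ∧ o ∈ K ∧
      ∀ y ∈ K, c * dist y x ≤ infDist y (frontier G) := by
  set δ := infDist o (frontier G) with hδ
  have hδ0 : 0 < δ := infDist_frontier_pos hG hf ho
  have hδD := infDist_frontier_le_diam hb hf ho
  set D := diam (closure G) with hD
  have hD0 : 0 < D := hδ0.trans_le hδD
  have hb0 : 0 < b₀ := by linarith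
  have hi1 : b₀⁻¹ ≤ 1 := inv_le_one_of_one_le₀ hb₀
  have hq : δ / (2 * D) ≤ 1 := by rw [div_le_one (by positivity)]; linarith
  refine ⟨b₀⁻¹ * (δ / (2 * D)), by positivity, fun x hx => ?_⟩
  by_cases hxo : x = o
  · subst hxo
    refine ⟨{x}, singleton_subset_iff.2 hx, isPreconnected_singleton, rfl, rfl, ?_⟩
    rintro y rfl
    rw [dist_self, mul_zero]
    exact infDist_nonneg
  obtain ⟨γ, hγ, h0, h1, hγG, hγd⟩ := hJ x hx o ho hxo
  refine ⟨γ '' Icc 0 1, image_subset_iff.2 hγG, isPreconnected_Icc.image _ hγ,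
    ⟨0, by simp, h0⟩, ⟨1, by simp, h1⟩, ?_⟩
  rintro _ ⟨t, ht, rfl⟩
  have hdD : dist (γ t) x ≤ D :=
    dist_le_diam_of_mem hb.closure (subset_closure (hγG t ht)) (subset_closure hx)
  have hle : δ / (2 * D) * dist (γ t) x ≤ δ / 2 := by
    calc δ / (2 * D) * dist (γ t) x ≤ δ / (2 * D) * D := by gcongr
      _ = δ / 2 := by field_simp
  have hle' : δ / (2 * D) * dist (γ t) x ≤ dist (γ t) x := mul_le_of_le_one_left dist_nonneg hq
  have hn : 0 ≤ δ / (2 * D) * dist (γ t) x := by positivity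
  rw [mul_assoc]
  rcases le_total (δ / 2) (dist (γ t) o) with h | h
  · refine le_trans ?_ (hγd t ht)
    gcongr
    exact le_min hle' (hle.trans h)
  · have h2 : δ ≤ infDist (γ t) (frontier G) + dist o (γ t) := infDist_le_infDist_add_dist
    rw [dist_comm] at h2
    exact (mul_le_of_le_one_left hn hi1).trans (by linarith)

/-- A Whitney-type cover of an open set by balls centred in a countable set. -/
lemma exists_whitney_centers {N : ℕ} {G : Set (Euc N)} (hG : IsOpen G)
    (hb : Bornology.IsBounded G) (hf : (frontier G).Nonempty) :
    ∃ u ⊆ G, u.Countable ∧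
      (u.PairwiseDisjoint fun z => closedBall z (infDist z (frontier G) / 100)) ∧
      G ⊆ ⋃ z ∈ u, ball z (infDist z (frontier G) / 10) := by
  obtain ⟨u, huG, hud, hu⟩ := Vitali.exists_disjoint_subfamily_covering_enlargement_closedBall
    G id (fun z => infDist z (frontier G) / 100) (diam (closure G))
    (fun z hz => (div_le_self infDist_nonneg (by norm_num)).trans
      (infDist_frontier_le_diam hb hf hz)) 5 (by norm_num)
  refine ⟨u, huG, hud.countable_of_nonempty_interior fun z hz => ?_, hud, fun x hx => ?_⟩
  · refine Nonempty.mono ball_subset_interior_closedBall ⟨z, mem_ball_self ?_⟩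
    exact div_pos (infDist_frontier_pos hG hf (huG hz)) (by norm_num)
  · obtain ⟨z, hz, hxz⟩ := hu x hx
    have h1 := hxz (mem_closedBall_self (div_nonneg infDist_nonneg (by norm_num)))
    rw [mem_closedBall] at h1
    have := infDist_frontier_pos hG hf (huG hz)
    refine mem_biUnion hz ?_
    rw [mem_ball]
    simp only [id] at h1
    linarith

lemma tsum_indicator_whitney_le {N : ℕ} {G : Set (Euc N)} (hG : IsOpen G)
    (hf : (frontier G).Nonempty) {u : Set (Euc N)} (huG : u ⊆ G) (huc : u.Countable)
    (hud : u.PairwiseDisjoint fun z => closedBall z (infDist z (frontier G) / 100)) (y : Euc N) :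
    ∑' z : u, (ball (z : Euc N) (infDist (z : Euc N) (frontier G) / 2)).indicator
      (fun _ => (1 : ℝ≥0∞)) y ≤ 300 ^ N := by
  have : Countable u := huc.to_subtype
  set d : Euc N → ℝ := fun x => infDist x (frontier G) with hd
  by_cases hy : ∃ z : u, y ∈ ball (z : Euc N) (d z / 2)
  swap
  · push Not at hy
    have : ∀ z : u, (ball (z : Euc N) (d z / 2)).indicator (fun _ => (1 : ℝ≥0∞)) y = 0 :=
      fun z => indicator_of_notMem (hy z) _
    simp [hd ▸ this]
  have hcmp : ∀ z : u, y ∈ ball (z : Euc N) (d z / 2) → d z / 2 ≤ d y ∧ d y ≤ 3 / 2 * d z := by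
    intro z hz
    rw [mem_ball] at hz
    have h1 : d y ≤ d z + dist y z := infDist_le_infDist_add_dist
    have h2 : d z ≤ d y + dist (z : Euc N) y := infDist_le_infDist_add_dist
    rw [dist_comm] at h2
    constructor <;> linarith
  have hdy : 0 < d y := by
    obtain ⟨z, hz⟩ := hy
    have h1 := infDist_frontier_pos hG hf (huG z.2)
    have h2 := (hcmp z hz).1
    simp only [hd] at h2 ⊢
    linarith
  set v := volume (closedBall y (d y / 150)) with hv
  have hv0 : v ≠ 0 := (measure_closedBall_pos _ _ (by positivity)).ne'
  have hvt : v ≠ ⊤ := measure_closedBall_lt_top.ne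
  let S : u → Set (Euc N) := fun z => {_x | y ∈ ball (z : Euc N) (d z / 2)} ∩
    closedBall (z : Euc N) (d z / 100)
  have hS : ∀ z : u, (ball (z : Euc N) (d z / 2)).indicator (fun _ => (1 : ℝ≥0∞)) y * v ≤
      volume (S z) := by
    intro z
    by_cases hz : y ∈ ball (z : Euc N) (d z / 2)
    · have e : S z = closedBall (z : Euc N) (d z / 100) := inter_eq_right.2 fun _ _ => hz
      have h2 := hcmp z hz
      rw [indicator_of_mem hz, one_mul, e, hv, Measure.addHaar_closedBall_center,
        ← Measure.addHaar_closedBall_center volume (z : Euc N)]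
      exact measure_mono (closedBall_subset_closedBall (by linarith))
    · rw [indicator_of_notMem hz, zero_mul]; exact zero_le
  have hsum : (∑' z : u, (ball (z : Euc N) (d z / 2)).indicator (fun _ => (1 : ℝ≥0∞)) y) * v ≤
      300 ^ N * v := by
    calc _ = ∑' z : u, (ball (z : Euc N) (d z / 2)).indicator (fun _ => (1 : ℝ≥0∞)) y * v :=
          ENNReal.tsum_mul_right.symm
      _ ≤ ∑' z : u, volume (S z) := ENNReal.tsum_le_tsum hS
      _ ≤ volume (⋃ z, S z) := by
          refine tsum_meas_le_meas_iUnion_of_disjoint _ (fun z =>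
            (MeasurableSet.const _).inter measurableSet_closedBall) fun z w hzw => ?_
          exact (hud z.2 w.2 (Subtype.coe_ne_coe.2 hzw)).mono inter_subset_right inter_subset_right
      _ ≤ volume (closedBall y (300 * (d y / 150))) := by
          refine measure_mono (iUnion_subset fun z x hx => ?_)
          have hz : y ∈ ball (z : Euc N) (d z / 2) := hx.1
          have h1 := (hcmp z hz).1
          have h2 : dist x z ≤ d z / 100 := hx.2
          rw [mem_ball] at hz
          rw [mem_closedBall]
          have := dist_triangle_right x y (z : Euc N)
          linarith
      _ = 300 ^ N * v := by
          rw [hv, Measure.addHaar_closedBall _ _ (by positivity),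
            Measure.addHaar_closedBall _ _ (by positivity), finrank_euclideanSpace_fin,
            mul_pow 300, ENNReal.ofReal_mul (by positivity), ← mul_assoc]
          congr 2
          rw [ENNReal.ofReal_pow (by positivity), ENNReal.ofReal_ofNat]
  exact (ENNReal.mul_le_mul_iff_left hv0 hvt).1 hsum

lemma tsum_rpow_le_rpow_tsum {ι : Type*} (f : ι → ℝ≥0∞) {q : ℝ} (hq : 1 ≤ q) :
    ∑' k, f k ^ q ≤ (∑' k, f k) ^ q := by
  have e : ∀ t : ℝ≥0∞, t ^ q = t * t ^ (q - 1) := fun t => by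
    conv_lhs => rw [← add_sub_cancel 1 q]
    rw [ENNReal.rpow_add_of_nonneg _ _ zero_le_one (by linarith), ENNReal.rpow_one]
  calc ∑' k, f k ^ q ≤ ∑' k, f k * (∑' k, f k) ^ (q - 1) := by
        refine ENNReal.tsum_le_tsum fun k => ?_
        rw [e]
        have := ENNReal.rpow_le_rpow (ENNReal.le_tsum (f := f) k) (show 0 ≤ q - 1 by linarith)
        gcongr
    _ = _ := by rw [ENNReal.tsum_mul_right, ← e]

lemma enorm_sub_mul_measure_le {X : Type*} [MeasurableSpace X] {μ : Measure X} {s A B : Set X}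
    (hA : s ⊆ A) (hB : s ⊆ B) {v : X → ℝ} (hv : AEMeasurable v (μ.restrict s)) (m n : ℝ) :
    ‖m - n‖ₑ * μ s ≤ ∫⁻ x in A, ‖v x - m‖ₑ ∂μ + ∫⁻ x in B, ‖v x - n‖ₑ ∂μ := by
  calc ‖m - n‖ₑ * μ s = ∫⁻ _ in s, ‖m - n‖ₑ ∂μ := (setLIntegral_const _ _).symm
    _ ≤ ∫⁻ x in s, (‖v x - m‖ₑ + ‖v x - n‖ₑ) ∂μ := by
        refine lintegral_mono fun x => ?_
        have e : m - n = (v x - n) - (v x - m) := by ring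
        rw [e, add_comm]
        exact enorm_sub_le
    _ = ∫⁻ x in s, ‖v x - m‖ₑ ∂μ + ∫⁻ x in s, ‖v x - n‖ₑ ∂μ :=
        lintegral_add_left' (hv.sub_const m).enorm _
    _ ≤ _ := add_le_add (lintegral_mono_set hA) (lintegral_mono_set hB)

lemma scaled_energy_rpow_le {N : ℕ} {r p α R D : ℝ} (hp : 1 ≤ p) (hpr : p ≤ r)
    (he : 0 ≤ (p * (1 - α) - N) * (r / p) + N) (hα : 0 ≤ α) (hR : 0 < R) (hRD : R ≤ D)
    {s : Set (Euc N)} (hs : MeasurableSet s) {w : Euc N → ℝ} (hw : ∀ x ∈ s, R ≤ w x)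
    (f : Euc N → ℝ≥0∞) :
    ((ENNReal.ofReal (R ^ (p - N)) * ∫⁻ x in s, f x) ^ (1 / p)) ^ r * ENNReal.ofReal R ^ N ≤
      ENNReal.ofReal (D ^ ((p * (1 - α) - N) * (r / p) + N)) *
        (∫⁻ x in s, ENNReal.ofReal (w x ^ (α * p)) * f x) ^ (r / p) := by
  have hp0 : 0 < p := by linarith
  have hr0 : 0 < r := by linarith
  have hq0 : 0 ≤ r / p := by positivity
  have h1 : ENNReal.ofReal (R ^ (p - N)) * ∫⁻ x in s, f x ≤ ENNReal.ofReal (R ^ (p * (1 - α) - N)) *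
      ∫⁻ x in s, ENNReal.ofReal (w x ^ (α * p)) * f x := by
    have e : R ^ (p - N) = R ^ (p * (1 - α) - N) * R ^ (α * p) := by
      rw [← Real.rpow_add hR]; ring_nf
    rw [e, ENNReal.ofReal_mul (by positivity), mul_assoc,
      ← lintegral_const_mul' _ _ ENNReal.ofReal_ne_top]
    gcongr ENNReal.ofReal (R ^ (p * (1 - α) - N)) * ?_
    refine setLIntegral_mono' hs fun x hx => ?_
    gcongr
    exact hw x hx
  calc _ = (ENNReal.ofReal (R ^ (p - N)) * ∫⁻ x in s, f x) ^ (r / p) * ENNReal.ofReal R ^ N := by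
        rw [← ENNReal.rpow_mul, one_div_mul_eq_div]
    _ ≤ (ENNReal.ofReal (R ^ (p * (1 - α) - N)) *
          ∫⁻ x in s, ENNReal.ofReal (w x ^ (α * p)) * f x) ^ (r / p) * ENNReal.ofReal R ^ N := by
        gcongr
    _ = ENNReal.ofReal (R ^ ((p * (1 - α) - N) * (r / p) + N)) *
          (∫⁻ x in s, ENNReal.ofReal (w x ^ (α * p)) * f x) ^ (r / p) := by
        rw [ENNReal.mul_rpow_of_nonneg _ _ hq0,
          ENNReal.ofReal_rpow_of_nonneg (Real.rpow_nonneg hR.le _) hq0,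
          ← Real.rpow_mul hR.le, mul_right_comm, ← ENNReal.ofReal_pow hR.le,
          ← ENNReal.ofReal_mul (by positivity), ← Real.rpow_natCast R N, ← Real.rpow_add hR]
    _ ≤ _ := by gcongr

/-- Weighted Sobolev-Poincaré inequality on John domains, with an unspecified constant in place of
the mean value. -/
lemma exists_weighted_sobolev_poincare_const {N : ℕ} (hN : 2 ≤ N) {G : Set (Euc N)}
    (hG : IsOpen G) (hne : G.Nonempty) (hb : Bornology.IsBounded G) {b₀ : ℝ} (hb₀ : 1 ≤ b₀)
    (hJ : IsJohn b₀ G) {r p α : ℝ} (hp : 1 ≤ p) (hpr : p ≤ r)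
    (he : 0 ≤ (p * (1 - α) - N) * (r / p) + N) (h1 : N * (1 / p - 1 / r) ≤ 1) (hα : 0 ≤ α) :
    ∃ C : ℝ≥0∞, C ≠ ⊤ ∧ ∀ v : Euc N → ℝ, IntegrableOn v G → DifferentiableOn ℝ v G → ∃ m : ℝ,
      ∫⁻ x in G, ‖v x - m‖ₑ ^ r ≤
        C * (∫⁻ x in G, ENNReal.ofReal (infDist x (frontier G) ^ (α * p)) *
          ‖fderiv ℝ v x‖ₑ ^ p) ^ (r / p) := by
  have hp0 : 0 < p := by linarith
  have hr0 : 0 < r := by linarith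
  have hr1 : 1 ≤ r := by linarith
  have hq0 : 0 ≤ r / p := by positivity
  have : Nontrivial (Euc N) := by
    have : Nontrivial (Fin N) := Fin.nontrivial_iff_two_le.2 hN
    infer_instance
  have hf := frontier_nonempty_of_isBounded hne hb
  obtain ⟨o, ho⟩ := hne
  set d : Euc N → ℝ := fun x => infDist x (frontier G) with hd
  have hdpos : ∀ x ∈ G, 0 < d x := fun x hx => infDist_frontier_pos hG hf hx
  have hdlip : ∀ x y, d x ≤ d y + dist x y := fun x y => infDist_le_infDist_add_dist
  have hdball : ∀ x ∈ G, ball x (d x) ⊆ G := fun x hx => ball_infDist_frontier_subset hG hx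
  obtain ⟨c, hc, hcarrot⟩ := hJ.exists_carrot hb₀ hG hb hf ho
  obtain ⟨u, huG, huc, hud, hucov⟩ := exists_whitney_centers hG hb hf
  have hoverlap := tsum_indicator_whitney_le hG hf huG huc hud
  have : Countable u := huc.to_subtype
  obtain ⟨C1, hC1, hSP⟩ := exists_sobolev_poincare_const hN hp hpr h1
  set lam : ℝ := 1 / 5 + 11 / (5 * c) with hlam
  obtain ⟨C2, hC2, hBoman⟩ := exists_lintegral_tsum_indicator_rpow_le N (ε := 1 / 50) (lam := lam)
    (by norm_num) (by rw [hlam]; have : 0 < 11 / (5 * c) := by positivity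
                      linarith) hr1
  let R : u → ℝ := fun k => d k / 2
  have hR : ∀ k, 0 < R k := fun k => half_pos (hdpos k (huG k.2))
  set V := volume (ball (0 : Euc N) 1) with hV
  have hV0 : V ≠ 0 := (measure_ball_pos _ _ one_pos).ne'
  have hVt : V ≠ ⊤ := measure_ball_lt_top.ne
  set C3 : ℝ≥0∞ := C1 * 10 ^ N / V with hC3
  have hC3t : C3 ≠ ⊤ := ENNReal.div_ne_top
    (ENNReal.mul_ne_top hC1 (ENNReal.pow_ne_top ENNReal.ofNat_ne_top)) hV0
  set C4 : ℝ≥0∞ := 2 ^ (r - 1) * (C1 + C2 * (2 * C3) ^ r) with hC4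
  set Dm : ℝ := diam (closure G) with hDm
  set C5 : ℝ≥0∞ := ENNReal.ofReal (Dm ^ ((p * (1 - α) - N) * (r / p) + N)) with hC5
  refine ⟨C4 * (C5 * (300 ^ N) ^ (r / p)), ?_, fun v hint hv => ?_⟩
  · refine ENNReal.mul_ne_top (ENNReal.mul_ne_top
      (ENNReal.rpow_ne_top_of_nonneg (by linarith) ENNReal.ofNat_ne_top)
      (ENNReal.add_ne_top.2 ⟨hC1, ENNReal.mul_ne_top hC2 (ENNReal.rpow_ne_top_of_nonneg hr0.le
        (ENNReal.mul_ne_top ENNReal.ofNat_ne_top hC3t))⟩)) (ENNReal.mul_ne_top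
      ENNReal.ofReal_ne_top (ENNReal.rpow_ne_top_of_nonneg hq0
        (ENNReal.pow_ne_top ENNReal.ofNat_ne_top)))
  have hWG : ∀ k : u, ball (k : Euc N) (R k) ⊆ G := fun k =>
    (ball_subset_ball (half_le_self (hdpos k (huG k.2)).le)).trans (hdball k (huG k.2))
  choose m hm1 hm2 using fun k : u => hSP k (R k) v (hR k) (hv.mono (hWG k))
    (hint.mono_set (hWG k))
  let s : u → ℝ≥0∞ := fun k => (ENNReal.ofReal (R k ^ (p - N)) *
    ∫⁻ x in ball (k : Euc N) (R k), ‖fderiv ℝ v x‖ₑ ^ p) ^ (1 / p)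
  have hvm : AEMeasurable v (volume.restrict G) := hint.aemeasurable
  let U : u → Set (Euc N) := fun k => ball (k : Euc N) (R k / 5)
  have hUW : ∀ k, U k ⊆ ball (k : Euc N) (R k) := fun k =>
    ball_subset_ball (by have := hR k; linarith)
  have hcov : ∀ x ∈ G, ∃ k, x ∈ U k := by
    intro x hx
    obtain ⟨z, hz, hxz⟩ := mem_iUnion₂.1 (hucov hx)
    refine ⟨⟨z, hz⟩, ?_⟩
    simp only [U, R, mem_ball, hd] at hxz ⊢
    linarith
  have hnbr : ∀ i j, (U i ∩ U j).Nonempty → ‖m i - m j‖ₑ ≤ C3 * s i + C3 * s j := by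
    rintro i j ⟨y, hyi, hyj⟩
    have hij : dist (i : Euc N) j < R i / 5 + R j / 5 :=
      (dist_triangle_left _ _ y).trans_lt (add_lt_add hyi hyj)
    have hle : R i ≤ 11 / 9 * R j := by
      have h2 := hdlip i j
      have e1 : d i = 2 * R i := by simp only [R]; ring
      have e2 : d j = 2 * R j := by simp only [R]; ring
      linarith
    have hsub : U j ⊆ ball (i : Euc N) (R i) := by
      have h2 := hdlip j i
      rw [dist_comm] at h2
      have e1 : d i = 2 * R i := by simp only [R]; ring
      have e2 : d j = 2 * R j := by simp only [R]; ring
      refine ball_subset_ball' ?_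
      rw [dist_comm]
      linarith
    have h3 := enorm_sub_mul_measure_le hsub (hUW j)
      (hvm.mono_set ((hUW j).trans (hWG j))) (m i) (m j)
    have hRj : ENNReal.ofReal (R i) ≤ 2 * ENNReal.ofReal (R j) := by
      rw [← ENNReal.ofReal_ofNat 2, ← ENNReal.ofReal_mul two_pos.le]
      exact ENNReal.ofReal_le_ofReal (by have := hR j; linarith)
    have hRj1 : ENNReal.ofReal (R j) ≤ 2 * ENNReal.ofReal (R j) :=
      le_mul_of_one_le_left' one_le_two
    set ρ := ENNReal.ofReal (R j) with hρ
    have hρ0 : ρ ≠ 0 := (ENNReal.ofReal_pos.2 (hR j)).ne'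
    have hρt : ρ ≠ ⊤ := ENNReal.ofReal_ne_top
    have hvol : volume (U j) * 5 ^ N = V * ρ ^ N := by
      simp only [U]
      rw [Measure.addHaar_ball_of_pos _ _ (by have := hR j; positivity),
        finrank_euclideanSpace_fin, hρ, ← ENNReal.ofReal_pow (hR j).le,
        mul_right_comm, ← ENNReal.ofReal_ofNat 5, ← ENNReal.ofReal_pow (by norm_num),
        ← ENNReal.ofReal_mul (by have := hR j; positivity), ← mul_pow,
        div_mul_cancel₀ _ (by norm_num), mul_comm]
    have h4 : ‖m i - m j‖ₑ * (V * ρ ^ N) ≤ (C3 * s i + C3 * s j) * (V * ρ ^ N) := by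
      calc ‖m i - m j‖ₑ * (V * ρ ^ N) = ‖m i - m j‖ₑ * volume (U j) * 5 ^ N := by
            rw [← hvol, mul_assoc]
        _ ≤ (C1 * ENNReal.ofReal (R i) ^ N * s i + C1 * ρ ^ N * s j) * 5 ^ N := by
            gcongr
            exact h3.trans (add_le_add (hm2 i) (hm2 j))
        _ ≤ (C1 * (2 * ρ) ^ N * s i + C1 * (2 * ρ) ^ N * s j) * 5 ^ N := by gcongr
        _ = C1 * 10 ^ N * (s i + s j) * ρ ^ N := by
            rw [mul_pow, show (10 : ℝ≥0∞) = 2 * 5 by norm_num, mul_pow]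
            ring
        _ = C3 * V * (s i + s j) * ρ ^ N := by rw [hC3, ENNReal.div_mul_cancel hV0 hVt]
        _ = _ := by ring
    exact (ENNReal.mul_le_mul_iff_left (mul_ne_zero hV0 (pow_ne_zero _ hρ0))
      (ENNReal.mul_ne_top hVt (ENNReal.pow_ne_top hρt))).1 h4
  obtain ⟨o', ho'⟩ := hcov o ho
  refine ⟨m o', ?_⟩
  let Φ : Euc N → ℝ≥0∞ := fun x => ∑' k : u,
    (closedBall (k : Euc N) (lam * R k)).indicator (fun _ => 2 * (C3 * s k)) x
  have hΦm : Measurable Φ := Measurable.tsum fun k =>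
    measurable_const.indicator measurableSet_closedBall
  have hchain : ∀ x ∈ G, ∀ i, x ∈ U i → ‖m i - m o'‖ₑ ≤ Φ x := by
    intro x hx i hi
    obtain ⟨K, hKG, hK, hxK, hoK, hKd⟩ := hcarrot x hx
    refine (enorm_sub_le_tsum_of_isPreconnected hK (U := U) (fun _ => isOpen_ball)
      (fun y hy => mem_iUnion.2 (hcov y (hKG hy))) hnbr ⟨x, hxK, hi⟩ ⟨o, hoK, ho'⟩).trans ?_
    refine ENNReal.tsum_le_tsum fun k => ?_
    by_cases hk : (K ∩ U k).Nonempty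
    · obtain ⟨y, hyK, hyk⟩ := hk
      have hxk : x ∈ closedBall (k : Euc N) (lam * R k) := by
        have h2 := hKd y hyK
        have h3 := hdlip y k
        have h4 : dist y k < R k / 5 := hyk
        have e1 : d k = 2 * R k := by simp only [R]; ring
        have h5 : dist y x ≤ 11 / (5 * c) * R k := by
          rw [div_mul_eq_mul_div, le_div_iff₀ (by positivity)]
          simp only [hd] at h3 e1
          linarith
        have h6 := dist_triangle_left x (k : Euc N) y
        rw [mem_closedBall, hlam, add_mul]
        linarith
      rw [indicator_of_mem hxk, indicator_of_mem (show k ∈ {k | (K ∩ U k).Nonempty} from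
        ⟨y, hyK, hyk⟩)]
    · rw [indicator_of_notMem (show k ∉ {k | (K ∩ U k).Nonempty} from hk)]
      exact zero_le
  have hloc : ∀ k, AEMeasurable ((U k).indicator fun x => ‖v x - m k‖ₑ ^ r) volume := fun k =>
    (aemeasurable_indicator_iff measurableSet_ball).2
      (((hvm.mono_set ((hUW k).trans (hWG k))).sub_const _).enorm.pow_const r)
  have hsum : ∫⁻ x in G, ‖v x - m o'‖ₑ ^ r ≤ C4 * ∑' k, s k ^ r * ENNReal.ofReal (R k) ^ N := by
    calc ∫⁻ x in G, ‖v x - m o'‖ₑ ^ r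
        ≤ ∫⁻ x in G, 2 ^ (r - 1) *
            (∑' k, (U k).indicator (fun x => ‖v x - m k‖ₑ ^ r) x + Φ x ^ r) := by
          refine setLIntegral_mono' hG.measurableSet fun x hx => ?_
          obtain ⟨i, hi⟩ := hcov x hx
          have e : v x - m o' = (v x - m i) + (m i - m o') := by ring
          rw [e]
          refine (ENNReal.rpow_le_rpow ((enorm_add_le _ _).trans
            (add_le_add_right (hchain x hx i hi) _)) hr0.le).trans ?_
          refine (ENNReal.rpow_add_le_mul_rpow_add_rpow _ _ hr1).trans ?_
          gcongr
          refine le_trans ?_ (ENNReal.le_tsum i)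
          rw [indicator_of_mem hi]
      _ ≤ ∫⁻ x, 2 ^ (r - 1) *
            (∑' k, (U k).indicator (fun x => ‖v x - m k‖ₑ ^ r) x + Φ x ^ r) :=
          setLIntegral_le_lintegral _ _
      _ = 2 ^ (r - 1) * ((∑' k, ∫⁻ x in U k, ‖v x - m k‖ₑ ^ r) + ∫⁻ x, Φ x ^ r) := by
          rw [lintegral_const_mul' _ _
            (ENNReal.rpow_ne_top_of_nonneg (by linarith) ENNReal.ofNat_ne_top),
            lintegral_add_right _ (hΦm.pow_const r), lintegral_tsum hloc]
          congr 2
          exact tsum_congr fun k => lintegral_indicator measurableSet_ball _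
      _ ≤ 2 ^ (r - 1) * (∑' k, C1 * ENNReal.ofReal (R k) ^ N * s k ^ r +
            C2 * ∑' k, (2 * (C3 * s k)) ^ r * ENNReal.ofReal (R k) ^ N) := by
          gcongr 2 ^ (r - 1) * (?_ + ?_)
          · exact ENNReal.tsum_le_tsum hm1
          · refine hBoman u (fun k => (k : Euc N)) R _ hR fun i j hij => ?_
            have := hud i.2 j.2 (Subtype.coe_ne_coe.2 hij)
            simp only [Function.onFun, R] at this ⊢
            convert this using 2 <;> ring
      _ = C4 * ∑' k, s k ^ r * ENNReal.ofReal (R k) ^ N := by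
          have e1 : ∀ k, C1 * ENNReal.ofReal (R k) ^ N * s k ^ r =
              C1 * (s k ^ r * ENNReal.ofReal (R k) ^ N) := fun k => by ring
          have e2 : ∀ k, (2 * (C3 * s k)) ^ r * ENNReal.ofReal (R k) ^ N =
              (2 * C3) ^ r * (s k ^ r * ENNReal.ofReal (R k) ^ N) := fun k => by
            rw [← mul_assoc 2, ENNReal.mul_rpow_of_nonneg _ _ hr0.le, mul_assoc]
          simp_rw [e1, e2]
          rw [ENNReal.tsum_mul_left, ENNReal.tsum_mul_left, hC4]
          ring
  set g : Euc N → ℝ≥0∞ := fun x => ENNReal.ofReal (d x ^ (α * p)) * ‖fderiv ℝ v x‖ₑ ^ p with hg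
  have hgm : Measurable g := by
    refine Measurable.mul ?_ ((measurable_fderiv ℝ v).enorm.pow_const p)
    exact ((continuous_infDist_pt _).measurable.pow_const _).ennreal_ofReal
  have hgsum : ∑' k : u, ∫⁻ x in ball (k : Euc N) (R k), g x ≤ 300 ^ N * ∫⁻ x in G, g x := by
    calc ∑' k : u, ∫⁻ x in ball (k : Euc N) (R k), g x
        = ∑' k : u, ∫⁻ x in G, (ball (k : Euc N) (R k)).indicator (fun _ => 1) x * g x := by
          refine tsum_congr fun k => ?_
          rw [← inter_eq_left.2 (hWG k), ← Measure.restrict_restrict measurableSet_ball,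
            ← lintegral_indicator measurableSet_ball]
          refine lintegral_congr fun x => ?_
          by_cases hx : x ∈ ball (k : Euc N) (R k)
          · simp only [indicator_of_mem hx, one_mul, inter_eq_left.2 (hWG k)]
          · simp only [indicator_of_notMem hx, zero_mul, inter_eq_left.2 (hWG k)]
      _ = ∫⁻ x in G, (∑' k : u, (ball (k : Euc N) (R k)).indicator (fun _ => 1) x) * g x := by
          simp_rw [← ENNReal.tsum_mul_right]
          exact (lintegral_tsum fun k =>
            ((measurable_const.indicator measurableSet_ball).mul hgm).aemeasurable).symm
      _ ≤ ∫⁻ x in G, 300 ^ N * g x := by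
          gcongr with x
          exact hoverlap x
      _ = _ := lintegral_const_mul _ hgm
  calc ∫⁻ x in G, ‖v x - m o'‖ₑ ^ r ≤ C4 * ∑' k, s k ^ r * ENNReal.ofReal (R k) ^ N := hsum
    _ ≤ C4 * ∑' k : u, C5 * (∫⁻ x in ball (k : Euc N) (R k), g x) ^ (r / p) := by
        refine mul_le_mul_right (ENNReal.tsum_le_tsum fun k => ?_) _
        refine scaled_energy_rpow_le hp hpr he hα (hR k) ?_ measurableSet_ball (fun x hx => ?_) _
        · exact (half_le_self (hdpos k (huG k.2)).le).trans
            (infDist_frontier_le_diam hb hf (huG k.2))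
        · have h2 := hdlip k x
          rw [dist_comm] at h2
          have e1 : d k = 2 * R k := by simp only [R]; ring
          have h3 : dist x k < R k := hx
          linarith
    _ ≤ C4 * (C5 * (300 ^ N * ∫⁻ x in G, g x) ^ (r / p)) := by
        rw [ENNReal.tsum_mul_left]
        gcongr
        refine (tsum_rpow_le_rpow_tsum _ (by rw [one_le_div hp0]; exact hpr)).trans ?_
        gcongr
    _ = _ := by
        rw [ENNReal.mul_rpow_of_nonneg _ _ hq0]
        ring

/-- Up to the factor `2 ^ r`, the average of `v` is an optimal constant in the `r`-th order mean
oscillation of `v`. -/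
lemma lintegral_sub_average_rpow_le {X : Type*} [MeasurableSpace X] {μ : Measure X}
    [IsFiniteMeasure μ] [NeZero μ] {v : X → ℝ} (hv : Integrable v μ) {r : ℝ} (hr : 1 ≤ r) (m : ℝ) :
    ∫⁻ x, ‖v x - ⨍ y, v y ∂μ‖ₑ ^ r ∂μ ≤ 2 ^ r * ∫⁻ x, ‖v x - m‖ₑ ^ r ∂μ := by
  have hr0 : 0 < r := by linarith
  have hμ0 : μ univ ≠ 0 := NeZero.ne _
  have hμt : μ univ ≠ ⊤ := measure_ne_top _ _
  have hint : Integrable (fun x => v x - m) μ := hv.sub (integrable_const m)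
  have hmeas : AEMeasurable (fun x => ‖v x - m‖ₑ) μ := hint.aestronglyMeasurable.enorm
  have havg : m - ⨍ y, v y ∂μ = -⨍ y, (v y - m) ∂μ := by
    have hpos : μ.real univ ≠ 0 := (ENNReal.toReal_pos hμ0 hμt).ne'
    simp only [average_eq, smul_eq_mul]
    rw [integral_sub hv (integrable_const m), integral_const, smul_eq_mul]
    field_simp
    ring
  have h1 : μ univ * ‖m - ⨍ y, v y ∂μ‖ₑ ≤ ∫⁻ x, ‖v x - m‖ₑ ∂μ := by
    have hb : ‖∫ y, (v y - m) ∂μ‖ₑ ≤ ∫⁻ x, ‖v x - m‖ₑ ∂μ := enorm_integral_le_lintegral_enorm _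
    refine le_trans (le_of_eq ?_) hb
    rw [havg, enorm_neg, ← measure_smul_average, enorm_smul]
    congr 1
    rw [measureReal_def, Real.enorm_eq_ofReal ENNReal.toReal_nonneg, ENNReal.ofReal_toReal hμt]
  have h2 : μ univ * ‖m - ⨍ y, v y ∂μ‖ₑ ^ r ≤ ∫⁻ x, ‖v x - m‖ₑ ^ r ∂μ := by
    have h3 := (ENNReal.rpow_le_rpow h1 hr0.le).trans
      (lintegral_rpow_le_measure_rpow_mul hmeas hr)
    have hsplit : μ univ ^ r = μ univ ^ (r - 1) * μ univ := by
      conv_rhs => rw [← ENNReal.rpow_one (μ univ), ← ENNReal.rpow_mul, one_mul]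
      rw [← ENNReal.rpow_add _ _ hμ0 hμt, sub_add_cancel]
    rw [ENNReal.mul_rpow_of_nonneg _ _ hr0.le, hsplit, mul_assoc] at h3
    exact (ENNReal.mul_le_mul_iff_right (ENNReal.rpow_pos hμ0.bot_lt hμt).ne'
      (ENNReal.rpow_ne_top_of_nonneg (by linarith) hμt)).1 h3
  calc ∫⁻ x, ‖v x - ⨍ y, v y ∂μ‖ₑ ^ r ∂μ
      ≤ ∫⁻ x, 2 ^ (r - 1) * (‖v x - m‖ₑ ^ r + ‖m - ⨍ y, v y ∂μ‖ₑ ^ r) ∂μ := by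
        refine lintegral_mono fun x => ?_
        refine le_trans (ENNReal.rpow_le_rpow ?_ hr0.le)
          (ENNReal.rpow_add_le_mul_rpow_add_rpow _ _ hr)
        simpa using enorm_add_le (v x - m) (m - ⨍ y, v y ∂μ)
    _ = 2 ^ (r - 1) * ((∫⁻ x, ‖v x - m‖ₑ ^ r ∂μ) + μ univ * ‖m - ⨍ y, v y ∂μ‖ₑ ^ r) := by
        rw [lintegral_const_mul' _ _ (ENNReal.rpow_ne_top_of_nonneg (by linarith) (by simp)),
          lintegral_add_right _ measurable_const, lintegral_const, mul_comm (μ univ)]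
    _ ≤ 2 ^ (r - 1) * ((∫⁻ x, ‖v x - m‖ₑ ^ r ∂μ) + ∫⁻ x, ‖v x - m‖ₑ ^ r ∂μ) := by gcongr
    _ = 2 ^ r * ∫⁻ x, ‖v x - m‖ₑ ^ r ∂μ := by
        rw [← two_mul, ← mul_assoc]
        congr 1
        conv_lhs => rw [← ENNReal.rpow_one 2, ← ENNReal.rpow_mul, one_mul]
        rw [← ENNReal.rpow_add _ _ (by simp) (by simp), sub_add_cancel]

lemma norm_gradient {F : Type*} [NormedAddCommGroup F] [InnerProductSpace ℝ F] [CompleteSpace F]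
    (v : F → ℝ) (x : F) : ‖gradient v x‖ = ‖fderiv ℝ v x‖ := by
  simp [gradient]

/-- weighted Poincaré inequality on John domains (Hurri–Syrjänen). -/
theorem stmt_0 {N : ℕ} (hN : 2 ≤ N) (G : Set (Euc N)) (hGopen : IsOpen G)
    (hGconn : IsConnected G) (hGbdd : Bornology.IsBounded G)
    (b₀ : ℝ) (hb₀ : 1 ≤ b₀) (hJohn : IsJohn b₀ G)
    (r p α : ℝ) (hp1 : 1 ≤ p) (hpr : p ≤ r)
    (hrle : r ≤ N * p / (N - p * (1 - α))) (hpN : p * (1 - α) < N)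
    (hα0 : 0 ≤ α) (hα1 : α ≤ 1) :
    ∃ C > (0:ℝ), ∀ v : Euc N → ℝ, IntegrableOn v G volume → DifferentiableOn ℝ v G →
      (∫⁻ x in G, ENNReal.ofReal (infDist x (frontier G) ^ (α * p) * ‖gradient v x‖ ^ p)) < ⊤ →
      (∫⁻ x in G, ENNReal.ofReal (|v x - ⨍ y in G, v y| ^ r)) ^ (1 / r) ≤
        ENNReal.ofReal C *
          (∫⁻ x in G, ENNReal.ofReal (infDist x (frontier G) ^ (α * p) * ‖gradient v x‖ ^ p))
            ^ (1 / p) := by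
  have hp0 : 0 < p := by linarith
  have hr0 : 0 < r := by linarith
  have hexp : r * (N - p * (1 - α)) ≤ N * p := (le_div_iff₀ (by linarith)).1 hrle
  have he : 0 ≤ (p * (1 - α) - N) * (r / p) + N := by
    rw [show (p * (1 - α) - N) * (r / p) + N = (N * p - r * (N - p * (1 - α))) / p by
      field_simp; ring]
    exact div_nonneg (by linarith) hp0.le
  have h1 : (N : ℝ) * (1 / p - 1 / r) ≤ 1 := by
    rw [show (N : ℝ) * (1 / p - 1 / r) = N * (r - p) / (p * r) by field_simp,
      div_le_one (by positivity)]
    nlinarith [mul_nonneg (mul_nonneg hp0.le hr0.le) hα0]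
  obtain ⟨C, hC, hmain⟩ := exists_weighted_sobolev_poincare_const hN hGopen hGconn.nonempty hGbdd
    hb₀ hJohn hp1 hpr he h1 hα0
  have hfin : IsFiniteMeasure (volume.restrict G) :=
    isFiniteMeasure_restrict.2 hGbdd.measure_lt_top.ne
  have hne : NeZero (volume.restrict G) :=
    ⟨by simpa using (hGopen.measure_pos volume hGconn.nonempty).ne'⟩
  have hK : (2 ^ r * C) ^ (1 / r) ≠ ⊤ :=
    ENNReal.rpow_ne_top_of_nonneg (by positivity)
      (ENNReal.mul_ne_top (ENNReal.rpow_ne_top_of_nonneg hr0.le (by simp)) hC)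
  refine ⟨((2 ^ r * C) ^ (1 / r)).toReal + 1, by positivity, fun v hv hd _ => ?_⟩
  obtain ⟨m, hm⟩ := hmain v hv hd
  have hL (x : Euc N) : ENNReal.ofReal (|v x - ⨍ y in G, v y| ^ r) =
      ‖v x - ⨍ y in G, v y‖ₑ ^ r := by
    rw [Real.enorm_eq_ofReal_abs, ENNReal.ofReal_rpow_of_nonneg (abs_nonneg _) hr0.le]
  have hR (x : Euc N) :
      ENNReal.ofReal (infDist x (frontier G) ^ (α * p) * ‖gradient v x‖ ^ p) =
        ENNReal.ofReal (infDist x (frontier G) ^ (α * p)) * ‖fderiv ℝ v x‖ₑ ^ p := by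
    rw [norm_gradient, ENNReal.ofReal_mul (Real.rpow_nonneg infDist_nonneg _),
      ← ENNReal.ofReal_rpow_of_nonneg (norm_nonneg _) hp0.le, ofReal_norm]
  simp only [hL, hR]
  set I := ∫⁻ x in G, ENNReal.ofReal (infDist x (frontier G) ^ (α * p)) * ‖fderiv ℝ v x‖ₑ ^ p
  calc (∫⁻ x in G, ‖v x - ⨍ y in G, v y‖ₑ ^ r) ^ (1 / r)
      ≤ (2 ^ r * (C * I ^ (r / p))) ^ (1 / r) := by
        gcongr
        exact (lintegral_sub_average_rpow_le hv (hp1.trans hpr) m).trans (by gcongr)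
    _ = (2 ^ r * C) ^ (1 / r) * I ^ (1 / p) := by
        rw [← mul_assoc, ENNReal.mul_rpow_of_nonneg _ _ (by positivity), ← ENNReal.rpow_mul]
        congr 2
        field_simp
    _ ≤ _ := by
        gcongr
        rw [← ENNReal.ofReal_toReal hK]
        exact ENNReal.ofReal_le_ofReal (by simp)
end
end

section
/- For every N ≥ 2, θ ∈ (0, π/2], ã > 0 and d > 0 there exists b₀ ≥ 1, depending only on N, θ, ã and d, such that every bounded domain G ⊂ ℝ^N with diameter at most d which satisfies the (θ,ã)-uniform interior cone condition is a b₀-John domain. -/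
open MeasureTheory Metric Set Real RealInnerProductSpace

noncomputable section

/-- The cone of half-opening `θ` around a unit vector `ω` contains the ball of radius
`T * sin θ` around `T • ω`. -/
theorem inner_smul_add_gt_norm_mul_cos {E : Type*} [NormedAddCommGroup E] [InnerProductSpace ℝ E]
    {θ T : ℝ} (hθ : θ ∈ Ioc (0 : ℝ) (π / 2)) {ω u : E} (hω : ‖ω‖ = 1)
    (hu : ‖u‖ < T * Real.sin θ) :
    ⟪T • ω + u, ω⟫ > ‖T • ω + u‖ * Real.cos θ := by
  have hs : 0 < Real.sin θ := Real.sin_pos_of_pos_of_lt_pi hθ.1 (by linarith [hθ.2, Real.pi_pos])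
  have hs1 : Real.sin θ ≤ 1 := Real.sin_le_one θ
  have hc : 0 ≤ Real.cos θ :=
    Real.cos_nonneg_of_neg_pi_div_two_le_of_le (by linarith [hθ.1, Real.pi_pos]) hθ.2
  have hsq := Real.sin_sq_add_cos_sq θ
  have hu0 := norm_nonneg u
  have hT : 0 < T := by
    by_contra! h
    nlinarith
  have hinner : ⟪T • ω + u, ω⟫ = T + ⟪u, ω⟫ := by
    rw [inner_add_left, real_inner_smul_left, real_inner_self_eq_norm_sq, hω]; ring
  have hnorm : ‖T • ω + u‖ ^ 2 = T ^ 2 + 2 * T * ⟪u, ω⟫ + ‖u‖ ^ 2 := by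
    rw [norm_add_sq_real, norm_smul, hω, real_inner_smul_left, real_inner_comm, mul_one,
      Real.norm_eq_abs, sq_abs]; ring
  have hcs : |⟪u, ω⟫| ≤ ‖u‖ := by simpa [hω] using abs_real_inner_le_norm u ω
  rw [hinner]
  set c : ℝ := ⟪u, ω⟫
  set n := ‖u‖
  set k := Real.cos θ
  set s := Real.sin θ
  have hpos : 0 < T + c := by nlinarith [neg_abs_le c]
  rcases hc.eq_or_lt with hk | hk
  · rw [← hk, mul_zero]; exact hpos
  · refine lt_of_pow_lt_pow_left₀ 2 hpos.le ?_
    rw [mul_pow, hnorm]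
    have hn : 0 < (T * s) ^ 2 - n ^ 2 := by nlinarith
    have key := mul_pos hn (pow_pos hk 2)
    have hk2 : k ^ 2 = 1 - s ^ 2 := by linarith
    rw [hk2] at key ⊢
    nlinarith [sq_nonneg (c + s ^ 2 * T)]

theorem ball_subset_or_exists_mem_frontier {E : Type*} [NormedAddCommGroup E] [NormedSpace ℝ E]
    [ProperSpace E] {G : Set E} (hG : IsOpen G) {p : E} (hp : p ∈ G) (r : ℝ) :
    ball p r ⊆ G ∨ ∃ x ∈ frontier G, dist p x < r := by
  by_cases hr : r ≤ infDist p Gᶜ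
  · exact .inl ((ball_subset_ball hr).trans ball_infDist_compl_subset)
  by_cases hne : (Gᶜ).Nonempty
  · obtain ⟨z, hz, hpz⟩ := hG.isClosed_compl.exists_infDist_eq_dist hne p
    refine .inr ⟨z, ?_, by linarith⟩
    have h0 : dist p z ≠ 0 := fun h => hz (dist_eq_zero.1 h ▸ hp)
    rw [hG.frontier_eq]
    refine ⟨closure_mono (ball_infDist_compl_subset (x := p)) ?_, hz⟩
    rw [hpz, closure_ball p h0, mem_closedBall, dist_comm]
  · rw [not_nonempty_iff_eq_empty, compl_empty_iff] at hne
    simp [hne]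

theorem le_infDist_frontier_of_ball_subset {X : Type*} [PseudoMetricSpace X] {G : Set X}
    (hG : IsOpen G) (hne : (frontier G).Nonempty) {z : X} {r : ℝ} (h : ball z r ⊆ G) :
    r ≤ infDist z (frontier G) := by
  refine (le_infDist hne).2 fun y hy => ?_
  by_contra! hlt
  rw [hG.frontier_eq] at hy
  exact hy.2 (h (by rwa [mem_ball, dist_comm]))

/-- Translating points of `G` near `p` along `v` moves them away from the complement of `G`,
at relative speed at least `s`. -/
def IsInwardPush {E : Type*} [NormedAddCommGroup E] [NormedSpace ℝ E]
    (G : Set E) (h s : ℝ) (p v : E) : Prop :=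
  ‖v‖ ≤ h ∧ ∀ w ∈ ball p (3 * h) ∩ closure G, ∀ t ∈ Ioc (0 : ℝ) 1,
    ball (w + t • v) (t * s * h) ⊆ G

theorem UnifConeCond.exists_isInwardPush {N : ℕ} {θ a : ℝ} (hθ : θ ∈ Ioc (0 : ℝ) (π / 2))
    (ha : 0 < a) {G : Set (Euc N)} (hG : IsOpen G) (hcone : UnifConeCond θ a G)
    {p : Euc N} (hp : p ∈ G) : ∃ v, IsInwardPush G (a / 8) (Real.sin θ) p v := by
  have hs : 0 < Real.sin θ := Real.sin_pos_of_pos_of_lt_pi hθ.1 (by linarith [hθ.2, Real.pi_pos])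
  have hs1 : Real.sin θ ≤ 1 := Real.sin_le_one θ
  rcases ball_subset_or_exists_mem_frontier hG hp (a / 2) with hb | ⟨x, hx, hpx⟩
  · refine ⟨0, by simpa using by positivity, fun w hw t ht z hz => hb ?_⟩
    rw [smul_zero, add_zero, mem_ball] at hz
    have hwp := mem_ball.1 hw.1
    have : t * Real.sin θ * (a / 8) ≤ 1 * 1 * (a / 8) := by gcongr; exact ht.2
    rw [mem_ball]
    linarith [dist_triangle z w p]
  · obtain ⟨ω, hω, hC⟩ := hcone x hx
    have hnv : ‖(a / 8) • ω‖ = a / 8 := by rw [norm_smul, hω, mul_one,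
      norm_of_nonneg (by positivity)]
    refine ⟨(a / 8) • ω, hnv.le, fun w hw t ht z hz => ?_⟩
    have hwx : w ∈ ball x a := by
      have hwp := mem_ball.1 hw.1
      rw [mem_ball]
      linarith [dist_triangle w p x]
    set u := z - (w + t • (a / 8) • ω)
    have hu : ‖u‖ < t * (a / 8) * Real.sin θ := by
      rw [mem_ball, dist_eq_norm] at hz
      linarith
    have hz' : z = w + ((t * (a / 8)) • ω + u) := by
      simp only [u, smul_smul]; abel
    rw [hz']
    have hta : t * (a / 8) ≤ 1 * (a / 8) := by gcongr; exact ht.2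
    have hta0 : 0 < t * (a / 8) := mul_pos ht.1 (by positivity)
    refine hC w ⟨hwx, hw.2⟩ _ (inner_smul_add_gt_norm_mul_cos hθ hω hu) ?_
    calc ‖(t * (a / 8)) • ω + u‖ ≤ ‖(t * (a / 8)) • ω‖ + ‖u‖ := norm_add_le _ _
      _ < a := by
        rw [norm_smul, hω, mul_one, norm_of_nonneg hta0.le]
        nlinarith

section InwardPush

variable {E : Type*} [NormedAddCommGroup E] [NormedSpace ℝ E] {G : Set E} {h s : ℝ}

theorem joinedIn_of_forall_add_smul {F : Set E} {x v : E}
    (hF : ∀ t ∈ Icc (0 : ℝ) 1, x + t • v ∈ F) : JoinedIn F x (x + v) := by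
  refine JoinedIn.of_segment_subset ?_
  rw [segment_eq_image', image_subset_iff]
  intro t ht
  simpa using hF t ht

/-- After a push by `v`, a second push by `v'` stays away from the complement of `G`. -/
theorem IsInwardPush.joinedIn_add (hs : 0 < s) (hs1 : s ≤ 1) (hh : 0 < h) {p q v v' : E}
    (hpq : dist q p < s * h / 2)
    (hv : ‖v‖ ≤ h) (hball : ball (q + v) (s * h) ⊆ G) (hv' : IsInwardPush G h s p v') :
    JoinedIn {z | ball z (s * h / 2) ⊆ G} (q + v) (q + v + v') := by
  have hsh : s * h ≤ h := by nlinarith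
  have hsh0 : 0 < s * h := by positivity
  refine joinedIn_of_forall_add_smul fun t ht z hz => ?_
  have hw : z - t • v' ∈ ball (q + v) (s * h / 2) := by
    rw [mem_ball, dist_eq_norm] at hz ⊢
    convert hz using 2; abel
  have hwG : z - t • v' ∈ G := hball (ball_subset_ball (by linarith) hw)
  rcases ht.1.eq_or_lt with h0 | h0
  · simpa [← h0] using hwG
  · have hwp : z - t • v' ∈ ball p (3 * h) := by
      have h1 := mem_ball.1 hw
      have h2 : dist (q + v) q ≤ h := by simpa using hv
      rw [mem_ball]
      linarith [dist_triangle (z - t • v') (q + v) p, dist_triangle (q + v) q p]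
    have := hv'.2 _ ⟨hwp, subset_closure hwG⟩ t ⟨h0, ht.2⟩
    refine this ?_
    rw [sub_add_cancel]
    exact mem_ball_self (by positivity)

theorem IsInwardPush.ball_subset {p q v : E} (hv : IsInwardPush G h s p v) (hq : q ∈ G)
    (hpq : dist q p < 3 * h) : ball (q + v) (s * h) ⊆ G := by
  simpa using hv.2 q ⟨mem_ball.2 hpq, subset_closure hq⟩ 1 (by simp)

theorem IsInwardPush.joinedIn_of_dist_lt (hs : 0 < s) (hs1 : s ≤ 1) (hh : 0 < h) {p q v v' : E}
    (hp : p ∈ G) (hq : q ∈ G) (hpq : dist q p < s * h / 2)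
    (hv : IsInwardPush G h s p v) (hv' : IsInwardPush G h s q v') :
    JoinedIn {z | ball z (s * h / 2) ⊆ G} (p + v) (q + v') := by
  have hsh : s * h ≤ h := by nlinarith
  have hsh0 : 0 < s * h := by positivity
  have h1 : JoinedIn {z | ball z (s * h / 2) ⊆ G} (p + v) (p + v + (q - p)) := by
    refine joinedIn_of_forall_add_smul fun t ht =>
      (ball_subset_ball' ?_).trans (hv.ball_subset hp (by rw [dist_self]; linarith))
    rw [dist_eq_norm, add_sub_cancel_left, norm_smul, norm_of_nonneg ht.1, ← dist_eq_norm]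
    nlinarith [ht.2, ht.1, dist_nonneg (x := q) (y := p)]
  rw [show p + v + (q - p) = q + v by abel] at h1
  have h2 := IsInwardPush.joinedIn_add hs hs1 hh (p := q) (by rw [dist_self]; linarith) hv.1
    (hv.ball_subset hq (by linarith)) hv'
  have h3 := IsInwardPush.joinedIn_add hs hs1 hh hpq hv'.1
    (hv'.ball_subset hq (by rw [dist_self]; linarith)) hv
  rw [add_right_comm] at h3
  exact h1.trans (h2.trans h3.symm)

theorem IsInwardPush.joinedIn (hs : 0 < s) (hs1 : s ≤ 1) (hh : 0 < h) (hG : IsPreconnected G)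
    (hex : ∀ p ∈ G, ∃ v, IsInwardPush G h s p v) {p q v v' : E} (hp : p ∈ G) (hq : q ∈ G)
    (hv : IsInwardPush G h s p v) (hv' : IsInwardPush G h s q v') :
    JoinedIn {z | ball z (s * h / 2) ⊆ G} (p + v) (q + v') := by
  refine hG.induction₂ (fun p q => ∀ v v', IsInwardPush G h s p v → IsInwardPush G h s q v' →
    JoinedIn {z | ball z (s * h / 2) ⊆ G} (p + v) (q + v')) ?_ ?_ ?_ hp hq v v' hv hv'
  · intro x hx
    filter_upwards [self_mem_nhdsWithin,
      mem_nhdsWithin_of_mem_nhds (ball_mem_nhds x (show 0 < s * h / 2 by positivity))]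
      with y hy hyx v v' hv hv'
    exact hv.joinedIn_of_dist_lt hs hs1 hh hx hy hyx hv'
  · intro x y z hx hy hz hxy hyz v v' hv hv'
    obtain ⟨w, hw⟩ := hex y hy
    exact (hxy v w hv hw).trans (hyz w v' hw hv')
  · exact fun x y hx hy hxy v v' hv hv' => (hxy v' v hv' hv).symm

/-- The segment from `p` to the pushed point `p + v` is a twisted cone with vertex `p`. -/
theorem IsInwardPush.joinedIn_self (hh : 0 < h) {b : ℝ} (hb : s⁻¹ ≤ b) (hs : 0 < s)
    (hG : IsOpen G) (hne : (frontier G).Nonempty) {p v : E} (hp : p ∈ G)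
    (hv : IsInwardPush G h s p v) :
    JoinedIn {z | z ∈ G ∧ b⁻¹ * dist z p ≤ infDist z (frontier G)} p (p + v) := by
  refine joinedIn_of_forall_add_smul fun t ht => ?_
  rcases ht.1.eq_or_lt with h0 | h0
  · simpa [← h0] using ⟨hp, infDist_nonneg⟩
  · have hball := hv.2 p ⟨mem_ball_self (by positivity), subset_closure hp⟩ t ⟨h0, ht.2⟩
    refine ⟨hball (mem_ball_self (by positivity)), ?_⟩
    refine le_trans ?_ (le_infDist_frontier_of_ball_subset hG hne hball)
    rw [dist_eq_norm, add_sub_cancel_left, norm_smul, norm_of_nonneg ht.1]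
    calc b⁻¹ * (t * ‖v‖) ≤ s * (t * h) := by
          gcongr
          · exact inv_le_of_inv_le₀ hs hb
          · exact hv.1
      _ = t * s * h := by ring

end InwardPush

/-- the uniform interior cone condition implies the John condition,
with a constant depending only on `N, θ, ã, d`. -/
theorem stmt_1 (N : ℕ) (hN : 2 ≤ N) (θ a d : ℝ) (hθ : θ ∈ Ioc (0:ℝ) (π / 2))
    (ha : 0 < a) (hd : 0 < d) :
    ∃ b₀ ≥ (1:ℝ), ∀ G : Set (Euc N), IsOpen G → IsConnected G → Bornology.IsBounded G →
      Metric.diam G ≤ d → UnifConeCond θ a G → IsJohn b₀ G := by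
  have hs : 0 < Real.sin θ := Real.sin_pos_of_pos_of_lt_pi hθ.1 (by linarith [hθ.2, Real.pi_pos])
  have hs1 : Real.sin θ ≤ 1 := Real.sin_le_one θ
  set s := Real.sin θ with hs_def
  have hh : 0 < a / 8 := by positivity
  set r := s * (a / 8) / 2 with hr_def
  have hr : 0 < r := by positivity
  have hdr : 0 < d / r := by positivity
  have hsi : 0 < s⁻¹ := by positivity
  refine ⟨1 + s⁻¹ + d / r, by linarith, fun G hG hconn hbdd hdiam hcone A hA B hB _ => ?_⟩
  have : Nonempty (Fin N) := ⟨⟨0, by lia⟩⟩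
  have hne : (frontier G).Nonempty := nonempty_frontier_iff.2 ⟨hconn.nonempty, by
    rintro rfl
    exact NormedSpace.unbounded_univ ℝ (Euc N) hbdd⟩
  set b := 1 + s⁻¹ + d / r with hb_def
  have hb : 0 < b := by positivity
  have hsb : s⁻¹ ≤ b := by linarith
  have hex : ∀ p ∈ G, ∃ v, IsInwardPush G (a / 8) s p v := fun p hp =>
    hcone.exists_isInwardPush hθ ha hG hp
  obtain ⟨v, hv⟩ := hex A hA
  obtain ⟨v', hv'⟩ := hex B hB
  let F : Set (Euc N) := {z | z ∈ G ∧ b⁻¹ * min (dist z A) (dist z B) ≤ infDist z (frontier G)}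
  have hF : JoinedIn F A B := by
    have h1 : JoinedIn F A (A + v) :=
      (hv.joinedIn_self hh hsb hs hG hne hA).mono fun z hz =>
        ⟨hz.1, le_trans (by gcongr; exact min_le_left _ _) hz.2⟩
    have h2 : JoinedIn F (A + v) (B + v') := by
      refine (hv.joinedIn hs hs1 hh hconn.isPreconnected hex hA hB hv').mono fun z hz => ?_
      have hzG : z ∈ G := hz (mem_ball_self hr)
      refine ⟨hzG, le_trans ?_ (le_infDist_frontier_of_ball_subset hG hne hz)⟩
      have hzd : min (dist z A) (dist z B) ≤ d :=
        (min_le_left _ _).trans ((dist_le_diam_of_mem hbdd hzG hA).trans hdiam)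
      rw [inv_mul_le_iff₀ hb]
      have : d / r * r ≤ b * r := by gcongr; linarith
      rw [div_mul_cancel₀ _ hr.ne'] at this
      exact hzd.trans this
    have h3 : JoinedIn F B (B + v') :=
      (hv'.joinedIn_self hh hsb hs hG hne hB).mono fun z hz =>
        ⟨hz.1, le_trans (by gcongr; exact min_le_right _ _) hz.2⟩
    exact h1.trans (h2.trans h3.symm)
  obtain ⟨γ, hγ⟩ := hF
  have hγF : ∀ t ∈ Icc (0 : ℝ) 1, γ.extend t ∈ F := fun t ht => by
    rw [γ.extend_apply ht]
    exact hγ _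
  exact ⟨γ.extend, γ.continuous_extend.continuousOn, γ.extend_zero, γ.extend_one,
    fun t ht => (hγF t ht).1, fun t ht => (hγF t ht).2⟩
end
end

section
/- Let Ω ⊂ ℝ^N (N ≥ 2) be a bounded domain and let u be a torsion function on Ω. Then −u(x) ≥ dist(x, ∂Ω)²/2 for every x in the closure of Ω. -/
open MeasureTheory Metric Set Real RealInnerProductSpace

noncomputable section

theorem deriv_deriv_nonpos_of_isLocalMax {f : ℝ → ℝ} {a : ℝ} (h : IsLocalMax f a)
    (hc : ContinuousAt f a) : deriv (deriv f) a ≤ 0 := by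
  by_contra! hpos
  have hmin : IsLocalMin f a := isLocalMin_of_deriv_deriv_pos hpos h.deriv_eq_zero hc
  have hconst : f =ᶠ[nhds a] fun _ => f a := by
    filter_upwards [h, hmin] with x hx hx'
    exact le_antisymm hx hx'
  have hzero := hconst.deriv.deriv_eq
  simp at hzero
  exact hpos.ne' hzero

theorem hessEntry_self_le_of_isLocalMax {N : ℕ} {Ω : Set (Euc N)} (hopen : IsOpen Ω)
    {u : Euc N → ℝ} (hu : ContDiffOn ℝ 2 u Ω) (c : ℝ) (p : Euc N) {y : Euc N} (hy : y ∈ Ω)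
    (hmax : IsLocalMax (fun z => u z - c * (‖z - p‖ ^ 2 / 2)) y) (i : Fin N) :
    hessEntry u y i i ≤ c := by
  set e : Euc N := EuclideanSpace.single i (1 : ℝ) with he
  have hnorm : ‖e‖ = 1 := by simp [he]
  let line : ℝ → Euc N := fun t => y + t • e
  let g : ℝ → ℝ := fun t => u (line t) - c * (‖line t - p‖ ^ 2 / 2)
  have hline : ∀ t, HasDerivAt line e t := fun t => by
    simpa [line] using ((hasDerivAt_id t).smul_const e).const_add y
  have hline0 : line 0 = y := by simp [line]
  have hcont : ContinuousAt line 0 := (hline 0).continuousAt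
  have hmem : ∀ᶠ t in nhds 0, line t ∈ Ω :=
    hcont.eventually (by rw [hline0]; exact hopen.mem_nhds hy)
  have hgmax : IsLocalMax g 0 := by
    have := hcont.eventually (by rw [hline0]; exact hmax)
    filter_upwards [this] with t ht
    simpa only [g, hline0] using ht
  have hsq : ∀ t, ‖line t - p‖ ^ 2 = ‖y - p‖ ^ 2 + 2 * (t * ⟪y - p, e⟫) + t ^ 2 := fun t => by
    have : line t - p = (y - p) + t • e := by simp only [line]; abel
    rw [this, norm_add_sq_real, inner_smul_right, norm_smul, hnorm]
    simp
  have hquad : ∀ t, HasDerivAt (fun s => c * (‖line s - p‖ ^ 2 / 2))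
      (c * (⟪y - p, e⟫ + t)) t := fun t => by
    simp only [hsq]
    have h₁ := ((hasDerivAt_id t).mul_const ⟪y - p, e⟫).const_mul 2
    have h₂ := (((h₁.const_add (‖y - p‖ ^ 2)).add (hasDerivAt_pow 2 t)).div_const 2).const_mul c
    refine h₂.congr_deriv ?_
    push_cast
    ring
  have hg : ∀ t, line t ∈ Ω →
      HasDerivAt g (fderiv ℝ u (line t) e - c * (⟪y - p, e⟫ + t)) t := fun t ht => by
    have hd : DifferentiableAt ℝ u (line t) :=
      (hu.contDiffAt (hopen.mem_nhds ht)).differentiableAt (by norm_num)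
    exact (hd.hasFDerivAt.comp_hasDerivAt t (hline t)).sub (hquad t)
  have hg' : deriv g =ᶠ[nhds 0] fun t => fderiv ℝ u (line t) e - c * (⟪y - p, e⟫ + t) := by
    filter_upwards [hmem] with t ht using (hg t ht).deriv
  have hfd : DifferentiableAt ℝ (fun z => fderiv ℝ u z e) (line 0) := by
    rw [hline0]
    have h := ((hu.contDiffAt (hopen.mem_nhds hy)).fderiv_right (m := 1)
      (by norm_num)).differentiableAt (by norm_num)
    exact h.clm_apply (differentiableAt_const e)
  have hsecond : HasDerivAt (fun t => fderiv ℝ u (line t) e - c * (⟪y - p, e⟫ + t))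
      (hessEntry u y i i - c) 0 := by
    have h₁ := hfd.hasFDerivAt.comp_hasDerivAt 0 (hline 0)
    have h₂ := ((hasDerivAt_id (0 : ℝ)).const_add ⟪y - p, e⟫).const_mul c
    refine (h₁.sub h₂).congr_deriv ?_
    simp [hessEntry, hline0, he]
  have hle := deriv_deriv_nonpos_of_isLocalMax hgmax (hg 0 (hline0 ▸ hy)).continuousAt
  rw [hg'.deriv_eq, hsecond.deriv] at hle
  linarith

/-- lower bound for `-u` in terms of the squared distance to the boundary. -/
theorem stmt_2 {N : ℕ} (hN : 2 ≤ N) (Ω : Set (Euc N)) (hopen : IsOpen Ω)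
    (hconn : IsConnected Ω) (hbdd : Bornology.IsBounded Ω)
    (u : Euc N → ℝ) (hu : IsTorsion Ω u) :
    ∀ x ∈ closure Ω, infDist x (frontier Ω) ^ 2 / 2 ≤ -u x := by
  obtain ⟨hcont, hsmooth, hlap, hzero⟩ := hu
  intro x hx
  by_cases hxf : x ∈ frontier Ω
  · simp [hzero x hxf, infDist_zero_of_mem hxf]
  have hbound : ∀ c ∈ Ico (0 : ℝ) 1, c * (infDist x (frontier Ω) ^ 2 / 2) ≤ -u x := by
    intro c hc
    have hvcont : ContinuousOn (fun z => u z - c * (‖z - x‖ ^ 2 / 2)) (closure Ω) :=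
      hcont.sub (by fun_prop)
    obtain ⟨y, hy, hymax⟩ := hbdd.isCompact_closure.exists_isMaxOn ⟨x, hx⟩ hvcont
    have hyf : y ∈ frontier Ω := by
      rw [hopen.frontier_eq]
      refine ⟨hy, fun hyΩ => ?_⟩
      have hloc := hymax.isLocalMax
        (Filter.mem_of_superset (hopen.mem_nhds hyΩ) subset_closure)
      have hle : lap u y ≤ N * c := by
        have := Finset.sum_le_card_nsmul Finset.univ (fun i => hessEntry u y i i) c
          fun i _ => hessEntry_self_le_of_isLocalMax hopen hsmooth c x hyΩ hloc i
        simpa [lap] using this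
      rw [hlap y hyΩ] at hle
      have hNpos : (0 : ℝ) < N := by exact_mod_cast (by omega : 0 < N)
      nlinarith [hc.2]
    have hxy : u x - c * (‖x - x‖ ^ 2 / 2) ≤ u y - c * (‖y - x‖ ^ 2 / 2) := hymax hx
    have hdist : infDist x (frontier Ω) ≤ ‖y - x‖ := by
      rw [← dist_eq_norm, dist_comm]
      exact infDist_le_dist_of_mem hyf
    have hmono : c * (infDist x (frontier Ω) ^ 2 / 2) ≤ c * (‖y - x‖ ^ 2 / 2) := by
      have := hc.1
      have := infDist_nonneg (x := x) (s := frontier Ω)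
      gcongr
    rw [hzero y hyf] at hxy
    simp at hxy
    linarith
  have hlim : Filter.Tendsto (fun c : ℝ => c * (infDist x (frontier Ω) ^ 2 / 2))
      (nhdsWithin 1 (Iio 1)) (nhds (1 * (infDist x (frontier Ω) ^ 2 / 2))) :=
    ((continuous_id.mul continuous_const).tendsto 1).mono_left nhdsWithin_le_nhds
  rw [one_mul] at hlim
  refine le_of_tendsto hlim ?_
  filter_upwards [Ico_mem_nhdsLT (zero_lt_one' ℝ)] with c hc using hbound c hc
end
end

section
/- Let Ω ⊂ ℝ^N (N ≥ 2) be a bounded domain satisfying the r_i-uniform interior sphere condition for some r_i > 0, and let u be a torsion function on Ω which is C¹ up to the boundary. Then |∇u(x)| ≥ r_i for every x ∈ ∂Ω. -/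
open MeasureTheory Metric Set Real RealInnerProductSpace

noncomputable section

theorem hessEntry_self_nonpos_of_isLocalMax {N : ℕ} {v : Euc N → ℝ} {p : Euc N}
    (hv : ContDiffAt ℝ 2 v p) (hmax : IsLocalMax v p) (i : Fin N) : hessEntry v p i i ≤ 0 := by
  by_contra! hpos
  set e : Euc N := EuclideanSpace.single i (1 : ℝ) with he
  have hline : ∀ s : ℝ, HasDerivAt (fun s : ℝ => p + s • e) e s := fun s => by
    simpa using ((hasDerivAt_id s).smul_const e).const_add p
  have hlim : Filter.Tendsto (fun s : ℝ => p + s • e) (nhds 0) (nhds p) := by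
    simpa using (hline 0).continuousAt.tendsto
  have hderiv : deriv (fun s : ℝ => v (p + s • e)) =ᶠ[nhds 0]
      fun s => fderiv ℝ v (p + s • e) e := by
    filter_upwards [hlim.eventually (hv.eventually (by simp))] with s hs
    exact ((hs.differentiableAt (by simp)).hasFDerivAt.comp_hasDerivAt s (hline s)).deriv
  have hsecond : HasDerivAt (deriv fun s : ℝ => v (p + s • e)) (hessEntry v p i i) 0 := by
    have hd : DifferentiableAt ℝ (fun y => fderiv ℝ v y e) (p + (0 : ℝ) • e) := by
      have : DifferentiableAt ℝ (fderiv ℝ v) p :=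
        (hv.fderiv_right (m := 1) (by norm_num)).differentiableAt (by simp)
      simpa using this.clm_apply (differentiableAt_const e)
    have := hd.hasFDerivAt.comp_hasDerivAt 0 (hline 0)
    simp only [zero_smul, add_zero] at this
    exact this.congr_of_eventuallyEq hderiv
  have hlmax : IsLocalMax (fun s : ℝ => v (p + s • e)) 0 := by
    have := hlim.eventually hmax
    simpa [IsLocalMax, IsMaxFilter] using this
  have hcont : ContinuousAt (fun s : ℝ => v (p + s • e)) 0 := by
    refine ContinuousAt.comp (g := v) ?_ (hline 0).continuousAt
    simpa using hv.continuousAt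
  have hlmin := isLocalMin_of_deriv_deriv_pos (by rwa [hsecond.deriv]) hlmax.deriv_eq_zero hcont
  have hconst : (fun s : ℝ => v (p + s • e)) =ᶠ[nhds 0] fun _ => v (p + (0 : ℝ) • e) := by
    filter_upwards [hlmax, hlmin] with s h₁ h₂ using le_antisymm h₁ h₂
  have hzero := hconst.deriv.deriv_eq
  simp only [deriv_const', deriv_const] at hzero
  rw [hsecond.deriv] at hzero
  exact hpos.ne' hzero

/-- Weak maximum principle for strictly subharmonic functions. -/
theorem nonpos_of_lap_pos {N : ℕ} {U : Set (Euc N)} (hU : IsOpen U)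
    (hb : Bornology.IsBounded U) {v : Euc N → ℝ} (hc : ContinuousOn v (closure U))
    (hv : ContDiffOn ℝ 2 v U) (hlap : ∀ x ∈ U, 0 < lap v x)
    (hfr : ∀ x ∈ frontier U, v x ≤ 0) : ∀ x ∈ closure U, v x ≤ 0 := by
  intro x hx
  obtain ⟨p, hp, hmax⟩ := hb.isCompact_closure.exists_isMaxOn ⟨x, hx⟩ hc
  refine (hmax hx).trans ?_
  by_cases hpU : p ∈ U
  · have hnhds : U ∈ nhds p := hU.mem_nhds hpU
    have hloc : IsLocalMax v p :=
      hmax.isLocalMax (Filter.mem_of_superset hnhds subset_closure)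
    exact absurd (hlap p hpU) (not_lt.mpr (Finset.sum_nonpos fun i _ =>
      hessEntry_self_nonpos_of_isLocalMax (hv.contDiffAt hnhds) hloc i))
  · exact hfr p (by rw [hU.frontier_eq]; exact ⟨hp, hpU⟩)

theorem lap_sub_const_mul_norm_sub_sq {N : ℕ} {u : Euc N → ℝ} {p : Euc N}
    (hu : ContDiffAt ℝ 2 u p) (a b : ℝ) (c : Euc N) :
    lap (fun y => u y - a * (‖y - c‖ ^ 2 - b)) p = lap u p - 2 * a * N := by
  have hess : ∀ i, hessEntry (fun y => u y - a * (‖y - c‖ ^ 2 - b)) p i i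
      = hessEntry u p i i - 2 * a := by
    intro i
    set e : Euc N := EuclideanSpace.single i (1 : ℝ) with he
    have hfirst : (fun y => fderiv ℝ (fun y => u y - a * (‖y - c‖ ^ 2 - b)) y e) =ᶠ[nhds p]
        fun y => fderiv ℝ u y e - 2 * a * inner ℝ (y - c) e := by
      filter_upwards [hu.eventually (by simp)] with y hy
      have h := (hy.differentiableAt (by simp)).hasFDerivAt.sub
        (((((hasFDerivAt_id y).sub_const c).norm_sq).sub_const b).const_mul a)
      have h' := congrArg (fun L => L e) h.fderiv
      simp at h'
      refine Eq.trans h' ?_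
      rw [inner_sub_left]
      ring
    have hd : DifferentiableAt ℝ (fun y => fderiv ℝ u y e) p :=
      ((hu.fderiv_right (m := 1) (by norm_num)).differentiableAt (by simp)).clm_apply
        (differentiableAt_const e)
    have h := hd.hasFDerivAt.sub
      ((((hasFDerivAt_id p).sub_const c).inner ℝ (hasFDerivAt_const e p)).const_mul (2 * a))
    have h' := congrArg (fun L => L e) (hfirst.fderiv_eq.trans h.fderiv)
    refine Eq.trans h' ?_
    simp [hessEntry, he]
  simp only [lap, hess, Finset.sum_sub_distrib, Finset.sum_const, Finset.card_univ,
    Fintype.card_fin, nsmul_eq_mul]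
  ring

theorem IsTorsion.nonpos {N : ℕ} (hN : 0 < N) {Ω : Set (Euc N)} (hopen : IsOpen Ω)
    (hbdd : Bornology.IsBounded Ω) {u : Euc N → ℝ} (hu : IsTorsion Ω u) :
    ∀ x ∈ closure Ω, u x ≤ 0 :=
  nonpos_of_lap_pos hopen hbdd hu.1 hu.2.1
    (fun x hx => by rw [hu.2.2.1 x hx]; exact_mod_cast hN) fun x hx => (hu.2.2.2 x hx).le

/-- Comparison of a torsion function with multiples of the torsion function of an inner ball. -/
theorem IsTorsion.le_of_ball_subset {N : ℕ} (hN : 0 < N) {Ω : Set (Euc N)} (hopen : IsOpen Ω)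
    (hbdd : Bornology.IsBounded Ω) {u : Euc N → ℝ} (hu : IsTorsion Ω u) {c : Euc N} {r : ℝ}
    (hr : 0 < r) (hball : ball c r ⊆ Ω) {q : ℝ} (hq : q < 1) {y : Euc N}
    (hy : y ∈ closedBall c r) : u y ≤ q / 2 * (‖y - c‖ ^ 2 - r ^ 2) := by
  have hcl : closure (ball c r) ⊆ closure Ω := closure_mono hball
  have hC2 : ContDiffOn ℝ 2 (fun y => u y - q / 2 * (‖y - c‖ ^ 2 - r ^ 2)) (ball c r) :=
    (hu.2.1.mono hball).sub (contDiff_const.mul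
      (((contDiff_id.sub contDiff_const).norm_sq ℝ).sub contDiff_const)).contDiffOn
  have key := nonpos_of_lap_pos (v := fun y => u y - q / 2 * (‖y - c‖ ^ 2 - r ^ 2))
    isOpen_ball isBounded_ball
    ((hu.1.mono hcl).sub (by fun_prop)) hC2 (fun x hx => ?_) (fun x hx => ?_) y
    (by rwa [closure_ball c hr.ne'])
  · linarith
  · rw [lap_sub_const_mul_norm_sub_sq (hu.2.1.contDiffAt (hopen.mem_nhds (hball hx))),
      hu.2.2.1 x (hball hx)]
    have : (0 : ℝ) < N := by exact_mod_cast hN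
    nlinarith
  · have hx' : ‖x - c‖ = r := by
      rw [frontier_ball c hr.ne'] at hx
      simpa [dist_eq_norm] using hx
    have := hu.nonpos hN hopen hbdd x (hcl (frontier_subset_closure hx))
    simpa [hx'] using this

/-- Hopf-type gradient lower bound on the boundary. -/
theorem stmt_4 {N : ℕ} (hN : 2 ≤ N) (Ω : Set (Euc N)) (hopen : IsOpen Ω)
    (hconn : IsConnected Ω) (hbdd : Bornology.IsBounded Ω)
    (r_i : ℝ) (hri : 0 < r_i) (hsph : IntSphere r_i Ω)
    (u : Euc N → ℝ) (hu : IsTorsion Ω u)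
    (g : Euc N → Euc N) (hgc : ContinuousOn g (closure Ω))
    (hgu : ∀ x ∈ Ω, g x = gradient u x) :
    ∀ x ∈ frontier Ω, r_i ≤ ‖g x‖ := by
  intro x hx
  obtain ⟨c, hball, hdist⟩ := hsph x hx
  have hN0 : 0 < N := by omega
  by_contra! hlt
  obtain ⟨k, hk, hkr⟩ := exists_between hlt
  have hxc : ‖x - c‖ = r_i := by rw [← dist_eq_norm, hdist]
  have hcx : ‖c - x‖ = r_i := by rw [norm_sub_rev, hxc]
  have hxcl : x ∈ closure Ω := frontier_subset_closure hx
  obtain ⟨δ, hδ, hclose⟩ : ∃ δ > 0, ∀ y ∈ Ω, dist y x < δ → ‖g y‖ < k := by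
    have hev := (hgc x hxcl).norm.eventually (gt_mem_nhds hk)
    obtain ⟨δ, hδ, h⟩ := Metric.mem_nhdsWithin_iff.mp hev
    exact ⟨δ, hδ, fun y hy hyx => h ⟨hyx, subset_closure hy⟩⟩
  obtain ⟨t, ht0, ht⟩ := exists_between
    (lt_min (lt_min one_pos (div_pos hδ hri)) (div_pos (sub_pos.mpr hkr) (mul_pos two_pos hri)))
  obtain ⟨ht', ht3⟩ := lt_min_iff.mp ht
  obtain ⟨ht1, ht2⟩ := lt_min_iff.mp ht'
  rw [lt_div_iff₀ hri] at ht2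
  rw [lt_div_iff₀ (mul_pos two_pos hri)] at ht3
  have hnorm : ∀ s : ℝ, s ≤ 1 → ‖x + s • (c - x) - c‖ = (1 - s) * r_i := by
    intro s hs
    have : x + s • (c - x) - c = (1 - s) • (x - c) := by module
    rw [this, norm_smul, hxc, Real.norm_of_nonneg (by linarith)]
  have hin : ∀ s : ℝ, 0 < s → s ≤ 1 → x + s • (c - x) ∈ Ω := by
    intro s h0 h1
    refine hball ?_
    rw [mem_ball, dist_eq_norm, hnorm s h1]
    nlinarith
  have hline : ∀ s : ℝ, HasDerivAt (fun s : ℝ => x + s • (c - x)) (c - x) s := fun s => by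
    simpa using ((hasDerivAt_id s).smul_const (c - x)).const_add x
  have hcont : ContinuousOn (fun s : ℝ => u (x + s • (c - x))) (Icc 0 t) := by
    refine hu.1.comp (f := fun s : ℝ => x + s • (c - x)) (by fun_prop) fun s hs => ?_
    rcases hs.1.eq_or_lt with rfl | h0
    · simpa using hxcl
    · exact subset_closure (hin s h0 (hs.2.trans ht1.le))
  have hdiff : ∀ s ∈ Ioo 0 t, HasDerivAt (fun s : ℝ => u (x + s • (c - x)))
      (inner ℝ (g (x + s • (c - x))) (c - x)) s := by
    intro s hs
    have hmem := hin s hs.1 (hs.2.trans ht1).le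
    have hd : DifferentiableAt ℝ u (x + s • (c - x)) :=
      (hu.2.1.contDiffAt (hopen.mem_nhds hmem)).differentiableAt (by simp)
    have := hd.hasGradientAt.hasFDerivAt.comp_hasDerivAt s (hline s)
    rw [hgu _ hmem]
    refine this.congr_deriv ?_
    simp
  obtain ⟨s, hs, hslope⟩ := exists_hasDerivAt_eq_slope _ _ ht0 hcont hdiff
  have hgs : ‖g (x + s • (c - x))‖ < k := by
    refine hclose _ (hin s hs.1 (hs.2.trans ht1).le) ?_
    rw [dist_eq_norm, add_sub_cancel_left, norm_smul, hcx, Real.norm_of_nonneg hs.1.le]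
    nlinarith [hs.2]
  have hlower : -(k * r_i) ≤ inner ℝ (g (x + s • (c - x))) (c - x) := by
    have h₁ := neg_le_of_abs_le (abs_real_inner_le_norm (g (x + s • (c - x))) (c - x))
    rw [hcx] at h₁
    nlinarith
  have hupper := hu.le_of_ball_subset hN0 hopen hbdd hri hball (q := 1 - t) (by linarith)
    (y := x + t • (c - x)) (by
      rw [mem_closedBall, dist_eq_norm, hnorm t ht1.le]
      nlinarith)
  rw [hnorm t ht1.le] at hupper
  rw [hslope, le_div_iff₀ (by linarith)] at hlower
  simp only [zero_smul, add_zero, hu.2.2.2 x hx, sub_zero] at hlower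
  have h₁ : t * r_i * ((1 - t) * (1 - t / 2) * r_i - k) ≤ 0 := by nlinarith
  have h₂ : 0 < (1 - t) * (1 - t / 2) * r_i - k := by
    nlinarith [mul_pos (mul_pos ht0 ht0) hri, mul_pos ht0 hri]
  exact absurd (mul_pos (mul_pos ht0 hri) h₂) (not_lt.mpr h₁)
end
end
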